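/- For every odd integer ℓ ≥ 3, the dimension δ_ℓ of the ℚ-vector space spanned by 1, ζ(3), ζ(5), …, ζ(ℓ) satisfies δ_ℓ ≥ (1/3)·log ℓ. -/

import Mathlib

/-- The values of the Riemann zeta function at integers `s ≥ 2`,
as a real number: `ζ(s) = ∑_{n ≥ 1} n^{-s}`. -/
noncomputable def zetaR (s : ℕ) : ℝ := ∑' n : ℕ, 1 / (n + 1 : ℝ) ^ s

/-- `δ_ℓ`: the dimension of the ℚ-vector subspace of ℝ spanned by
`1, ζ(3), ζ(5), …, ζ(ℓ)` (odd arguments `3 ≤ s ≤ ℓ`). -/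
noncomputable def deltaDim (ℓ : ℕ) : ℕ :=
  Module.finrank ℚ
    (Submodule.span ℚ
      (({1} : Set ℝ) ∪ {x : ℝ | ∃ s : ℕ, Odd s ∧ 3 ≤ s ∧ s ≤ ℓ ∧ x = zetaR s}))

open Finset Filter Topology

theorem choose_mul_pow_mul_pow_le (x y N k : ℕ) (hk : k ≤ N) :
    N.choose k * (x ^ k * y ^ (N - k)) ≤ (x + y) ^ N := by
  rw [add_pow, mul_comm]
  exact single_le_sum (f := fun m ↦ x ^ m * y ^ (N - m) * N.choose m) (fun _ _ ↦ Nat.zero_le _)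
    (mem_range.2 (Nat.lt_succ_of_le hk))

theorem factorization_factorial_eq_sum_log {p n b : ℕ} (hp : p.Prime) (hb : n < p ^ b) :
    n.factorial.factorization p = ∑ i ∈ Ico 1 b, n / p ^ i := by
  rcases Nat.eq_zero_or_pos n with rfl | hn
  · simp
  · exact Nat.factorization_factorial hp (Nat.log_lt_of_lt_pow hn.ne' hb)

theorem log_eq_sum_ite {p n b : ℕ} (hp : 1 < p) (hn : n ≠ 0) (hb : n < p ^ b) :
    Nat.log p n = ∑ i ∈ Ico 1 b, if p ^ i ≤ n then 1 else 0 := by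
  rw [← card_filter]
  have : (Ico 1 b).filter (fun i ↦ p ^ i ≤ n) = Ico 1 (Nat.log p n + 1) := by
    ext i
    simp only [mem_filter, mem_Ico, Nat.lt_succ_iff, ← Nat.le_log_iff_pow_le hp hn]
    have := Nat.log_lt_of_lt_pow hn hb
    omega
  rw [this]; simp

theorem lcmUpto_dvd_mul_choose (m : ℕ) (hm : m ≠ 0) :
    Nat.lcmUpto (42 * m) ∣ Nat.lcmUpto m *
      ((42 * m).choose (21 * m) * (21 * m).choose (14 * m) * (7 * m).choose (6 * m)) := by
  set M := (42 * m).choose (21 * m) * (21 * m).choose (14 * m) * (7 * m).choose (6 * m) with hM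
  have hM0 : M ≠ 0 := by
    simp only [hM, ne_eq, mul_eq_zero, not_or]
    refine ⟨⟨?_, ?_⟩, ?_⟩ <;> exact (Nat.choose_pos (by omega)).ne'
  have hfac : M * ((21 * m).factorial * (14 * m).factorial * (6 * m).factorial * m.factorial)
      = (42 * m).factorial := by
    have h1 := Nat.choose_mul_factorial_mul_factorial (n := 42 * m) (k := 21 * m) (by omega)
    have h2 := Nat.choose_mul_factorial_mul_factorial (n := 21 * m) (k := 14 * m) (by omega)
    have h3 := Nat.choose_mul_factorial_mul_factorial (n := 7 * m) (k := 6 * m) (by omega)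
    rw [show 42 * m - 21 * m = 21 * m by omega] at h1
    rw [show 21 * m - 14 * m = 7 * m by omega] at h2
    rw [show 7 * m - 6 * m = m by omega] at h3
    rw [← h1, hM]
    nth_rewrite 2 [← h2]
    rw [← h3]
    ring
  rw [← Nat.factorization_le_iff_dvd (Nat.lcmUpto_ne_zero _)
    (mul_ne_zero (Nat.lcmUpto_ne_zero _) hM0)]
  intro p
  by_cases hp : p.Prime
  swap
  · simp [Nat.factorization_eq_zero_of_not_prime _ hp]
  rw [Nat.factorization_mul (Nat.lcmUpto_ne_zero _) hM0, Finsupp.add_apply,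
    Nat.factorization_lcmUpto _ hp, Nat.factorization_lcmUpto _ hp]
  have hf := congrArg (fun n ↦ n.factorization p) hfac
  have h0 (n : ℕ) : n.factorial ≠ 0 := Nat.factorial_ne_zero n
  clear_value M
  rw [Nat.factorization_mul hM0 (by simp [h0]), Nat.factorization_mul (by simp [h0]) (h0 _),
    Nat.factorization_mul (by simp [h0]) (h0 _), Nat.factorization_mul (h0 _) (h0 _)] at hf
  simp only [Finsupp.add_apply] at hf
  obtain ⟨b, hb⟩ : ∃ b, 42 * m < p ^ b := ⟨_, Nat.lt_pow_self hp.one_lt⟩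
  rw [factorization_factorial_eq_sum_log hp (b := b) (by omega),
    factorization_factorial_eq_sum_log hp (b := b) (by omega),
    factorization_factorial_eq_sum_log hp (b := b) (by omega),
    factorization_factorial_eq_sum_log hp (b := b) (by omega),
    factorization_factorial_eq_sum_log hp (b := b) (by omega)] at hf
  rw [log_eq_sum_ite hp.one_lt (by omega) hb, log_eq_sum_ite hp.one_lt hm (b := b) (by omega)]
  have key : ∑ i ∈ Ico 1 b, ((if p ^ i ≤ 42 * m then 1 else 0) + (21 * m / p ^ i + 14 * m / p ^ i
      + 6 * m / p ^ i + m / p ^ i)) ≤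
      ∑ i ∈ Ico 1 b, ((if p ^ i ≤ m then 1 else 0) + 42 * m / p ^ i) := by
    refine sum_le_sum fun i _ ↦ ?_
    have hq : 0 < p ^ i := pow_pos hp.pos i
    generalize p ^ i = q at hq
    have e1 : 21 * m / q = (42 * m / q) / 2 := by
      rw [Nat.div_div_eq_div_mul, mul_comm q, ← Nat.div_div_eq_div_mul]; congr 1; omega
    have e2 : 14 * m / q = (42 * m / q) / 3 := by
      rw [Nat.div_div_eq_div_mul, mul_comm q, ← Nat.div_div_eq_div_mul]; congr 1; omega
    have e3 : 6 * m / q = (42 * m / q) / 7 := by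
      rw [Nat.div_div_eq_div_mul, mul_comm q, ← Nat.div_div_eq_div_mul]; congr 1; omega
    have e4 : m / q = (42 * m / q) / 42 := by
      rw [Nat.div_div_eq_div_mul, mul_comm q, ← Nat.div_div_eq_div_mul]; congr 1; omega
    have h1 : q ≤ m ↔ 42 ≤ 42 * m / q := by
      rw [Nat.le_div_iff_mul_le hq]; omega
    have h2 : q ≤ 42 * m ↔ 1 ≤ 42 * m / q := by
      rw [Nat.le_div_iff_mul_le hq]; omega
    simp only [e1, e2, e3, h1, h2]
    rw [e4]
    generalize 42 * m / q = y
    split_ifs <;> omega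
  simp only [sum_add_distrib] at key
  omega

theorem lcmUpto_mono {m n : ℕ} (h : m ≤ n) : Nat.lcmUpto m ≤ Nat.lcmUpto n := by
  refine Nat.le_of_dvd (Nat.lcmUpto_pos n) ?_
  exact Finset.lcm_mono (Icc_subset_Icc_right h)

theorem choose_mul_choose_mul_choose_le (m : ℕ) :
    (42 * m).choose (21 * m) * (21 * m).choose (14 * m) * (7 * m).choose (6 * m) *
      (21 ^ 21 * 14 ^ 14 * 6 ^ 6) ^ m ≤ (42 ^ 42) ^ m := by
  have h1 := choose_mul_pow_mul_pow_le 21 21 (42 * m) (21 * m) (by omega)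
  have h2 := choose_mul_pow_mul_pow_le 14 7 (21 * m) (14 * m) (by omega)
  have h3 := choose_mul_pow_mul_pow_le 6 1 (7 * m) (6 * m) (by omega)
  rw [show 42 * m - 21 * m = 21 * m by omega] at h1
  rw [show 21 * m - 14 * m = 7 * m by omega] at h2
  rw [show 7 * m - 6 * m = m by omega] at h3
  simp only [one_pow, mul_one] at h3
  norm_num only [] at h1 h2 h3
  have h := Nat.mul_le_mul (Nat.mul_le_mul h1 h2) h3
  have hpos : 0 < 21 ^ (21 * m) * 7 ^ (7 * m) := by positivity
  refine Nat.le_of_mul_le_mul_right ?_ hpos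
  calc _ = _ := ?_
    _ ≤ _ := h
    _ = _ := ?_
  · simp only [mul_pow, ← pow_mul]; ring
  · simp only [← pow_mul]; ring

theorem exists_lcmUpto_le_pow :
    ∃ C : ℝ, 1 ≤ C ∧ ∀ n, (Nat.lcmUpto n : ℝ) ≤ C * (303 / 100 : ℝ) ^ n := by
  set D : ℝ := 303 / 100 with hD
  set G : ℝ := 42 ^ 42 / (21 ^ 21 * 14 ^ 14 * 6 ^ 6) with hG
  have hD1 : 1 ≤ D := by norm_num [hD]
  have hG0 : 0 < G := by positivity
  have hGD : G * D < D ^ 42 := by rw [hG, hD]; norm_num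
  have hrat : 1 < D ^ 42 / (G * D) := (one_lt_div (by positivity)).2 hGD
  have hstep (m : ℕ) (hm : m ≠ 0) :
      (Nat.lcmUpto (42 * m) : ℝ) ≤ Nat.lcmUpto m * G ^ m := by
    have h1 := Nat.le_of_dvd (Nat.mul_pos (Nat.lcmUpto_pos _) (Nat.mul_pos (Nat.mul_pos
      (Nat.choose_pos (by omega)) (Nat.choose_pos (by omega))) (Nat.choose_pos (by omega))))
      (lcmUpto_dvd_mul_choose m hm)
    have h2 := choose_mul_choose_mul_choose_le m
    have h1' : (Nat.lcmUpto (42 * m) : ℝ) ≤ Nat.lcmUpto m *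
      (((42 * m).choose (21 * m) * (21 * m).choose (14 * m) * (7 * m).choose (6 * m) : ℕ) : ℝ) := by
      exact_mod_cast h1
    refine h1'.trans (mul_le_mul_of_nonneg_left ?_ (Nat.cast_nonneg _))
    rw [hG, div_pow, le_div_iff₀ (by positivity)]
    exact_mod_cast h2
  obtain ⟨m₀, hm₀⟩ := pow_unbounded_of_one_lt (G * D) hrat
  have hlarge (m : ℕ) (hm : m₀ ≤ m) : (G * D) ^ (m + 1) ≤ D ^ (42 * m) := by
    have h := hm₀.le.trans (pow_le_pow_right₀ hrat.le hm)
    rw [div_pow, le_div_iff₀ (by positivity)] at h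
    rw [pow_mul, pow_succ, mul_comm]
    exact h
  set N := 42 * (m₀ + 2)
  refine ⟨Nat.lcmUpto N, by exact_mod_cast Nat.lcmUpto_pos N, fun n ↦ ?_⟩
  induction n using Nat.strong_induction_on with
  | _ n ih =>
    by_cases hn : n ≤ N
    · have h1 : (Nat.lcmUpto n : ℝ) ≤ Nat.lcmUpto N := by
        exact_mod_cast lcmUpto_mono hn
      exact h1.trans (le_mul_of_one_le_right (Nat.cast_nonneg _) (one_le_pow₀ hD1))
    · set m := n / 42 with hm
      have hlt : m + 1 < n := by omega
      calc (Nat.lcmUpto n : ℝ) ≤ Nat.lcmUpto (42 * (m + 1)) := by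
            exact_mod_cast lcmUpto_mono (by omega)
        _ ≤ Nat.lcmUpto (m + 1) * G ^ (m + 1) := hstep _ (by omega)
        _ ≤ (Nat.lcmUpto N * D ^ (m + 1)) * G ^ (m + 1) := by gcongr; exact ih _ hlt
        _ = Nat.lcmUpto N * (G * D) ^ (m + 1) := by rw [mul_pow]; ring
        _ ≤ Nat.lcmUpto N * D ^ (42 * m) := by gcongr; exact hlarge m (by omega)
        _ ≤ Nat.lcmUpto N * D ^ n := by
            gcongr
            omega

theorem exists_simultaneous_approx {s : ℕ} (ξ : Fin s → ℝ) {N : ℕ} (hN : 0 < N) :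
    ∃ q : ℕ, 0 < q ∧ q ≤ N ^ s ∧ ∃ p : Fin s → ℤ, ∀ i, |q * ξ i - p i| ≤ 1 / N := by
  have hN' : (0 : ℝ) < N := Nat.cast_pos.2 hN
  let f : ℕ → Fin s → ℕ := fun j i ↦ ⌊Int.fract (j * ξ i) * N⌋₊
  have hf (j : ℕ) (i : Fin s) :
      (f j i : ℝ) ≤ Int.fract (j * ξ i) * N ∧ Int.fract (j * ξ i) * N < f j i + 1 :=
    ⟨Nat.floor_le (mul_nonneg (Int.fract_nonneg _) hN'.le), Nat.lt_floor_add_one _⟩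
  have hmaps : Set.MapsTo f (range (N ^ s + 1)) (Fintype.piFinset fun _ : Fin s ↦ range N) := by
    intro j _
    rw [mem_coe, Fintype.mem_piFinset]
    intro i
    rw [mem_range]
    have h : (f j i : ℝ) < N := (hf j i).1.trans_lt
      (mul_lt_of_lt_one_left hN' (Int.fract_lt_one _))
    exact_mod_cast h
  have hcard : #(Fintype.piFinset fun _ : Fin s ↦ range N) < #(range (N ^ s + 1)) := by
    simp [Fintype.card_piFinset]
  obtain ⟨x, hx, y, hy, hxy, hfxy⟩ := exists_ne_map_eq_of_card_lt_of_maps_to hcard hmaps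
  wlog h : x < y generalizing x y
  · exact this y hy x hx hxy.symm hfxy.symm (by omega)
  rw [mem_range] at hx hy
  refine ⟨y - x, by omega, by omega, fun i ↦ ⌊y * ξ i⌋ - ⌊x * ξ i⌋, fun i ↦ ?_⟩
  have h1 := hf x i
  have h2 := hf y i
  rw [← congrFun hfxy i] at h2
  rw [le_div_iff₀ hN', ← abs_of_pos hN', ← abs_mul]
  beta_reduce
  have e : ((y - x : ℕ) * ξ i - ((⌊y * ξ i⌋ - ⌊x * ξ i⌋ : ℤ) : ℝ)) * N
      = Int.fract (y * ξ i) * N - Int.fract (x * ξ i) * N := by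
    rw [Nat.cast_sub h.le, ← Int.self_sub_floor, ← Int.self_sub_floor]
    push_cast
    ring
  rw [e, abs_le]
  constructor <;> linarith

/-- Nesterenko's linear independence criterion: there are no small integer linear forms in
`1, ξ₁, …, ξₛ` which are too small with respect to the size `b` of their coefficients and
to the ratio `M` of consecutive forms. -/
theorem nesterenko_criterion {s : ℕ} (ξ : Fin s → ℝ) (L : ℕ → ℝ) (l₀ : ℕ → ℤ)
    (l : ℕ → Fin s → ℤ) (b M : ℕ → ℝ) (hL : ∀ n, 0 < L n)
    (hform : ∀ n, L n = l₀ n + ∑ i, l n i * ξ i) (hl : ∀ n i, |(l n i : ℝ)| ≤ b n)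
    (hb : ∀ n, 1 ≤ b n) (hM : ∀ n, 1 ≤ M n) (hratio : ∀ n, L n ≤ M n * L (n + 1))
    (hlim : Tendsto (fun n ↦ (b (n + 1) * M n) ^ s * L n) atTop (𝓝 0)) : False := by
  have key (N q n : ℕ) (p : Fin s → ℤ) (hp : ∀ i, |q * ξ i - p i| ≤ 1 / N)
      (h1 : q * L n ≤ 1 / 4) (h2 : s * b n / N < 1 / 4) (h3 : s * b n / N < q * L n) : False := by
    set I : ℤ := l₀ n * q + ∑ i, l n i * p i
    have hI : (I : ℝ) = q * L n - ∑ i, l n i * (q * ξ i - p i) := by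
      simp only [I, hform n, mul_sub, sum_sub_distrib, mul_add, mul_sum]
      push_cast
      have : ∀ i, (q : ℝ) * (l n i * ξ i) = l n i * (q * ξ i) := fun i ↦ by ring
      simp only [this]
      ring
    have herr : |∑ i, (l n i : ℝ) * (q * ξ i - p i)| ≤ s * b n / N := by
      calc _ ≤ ∑ i, |(l n i : ℝ) * (q * ξ i - p i)| := abs_sum_le_sum_abs _ _
        _ ≤ ∑ _i : Fin s, b n * (1 / N) := by
            refine sum_le_sum fun i _ ↦ ?_
            rw [abs_mul]
            exact mul_le_mul (hl n i) (hp i) (abs_nonneg _) (by linarith [hb n])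
        _ = _ := by simp; ring
    rw [abs_le] at herr
    have hI1 : (I : ℝ) < 1 := by linarith
    have hI2 : (0 : ℝ) < I := by linarith
    have hI1' : I < 1 := by exact_mod_cast hI1
    have hI2' : 0 < I := by exact_mod_cast hI2
    omega
  have hLlim : Tendsto L atTop (𝓝 0) := by
    refine squeeze_zero (fun n ↦ (hL n).le) (fun n ↦ ?_) hlim
    exact le_mul_of_one_le_left (hL n).le
      (one_le_pow₀ (one_le_mul_of_one_le_of_one_le (hb _) (hM _)))
  have hev : ∀ᶠ n in atTop, (4 * s * (b (n + 1) * M n)) ^ s * (4 * L n) < 1 := by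
    have h := hlim.const_mul ((4 * s : ℝ) ^ s * 4)
    rw [mul_zero] at h
    filter_upwards [h.eventually_lt_const one_pos] with n hn
    rw [mul_pow]
    linarith
  obtain ⟨n₀, hn₀⟩ := eventually_atTop.1 hev
  obtain ⟨N, hN⟩ := exists_nat_gt (max (4 * (s * b n₀)) (s * b n₀ / L n₀))
  have hsb : 0 ≤ s * b n₀ := mul_nonneg (Nat.cast_nonneg _) (zero_le_one.trans (hb _))
  have hN' : (0 : ℝ) < N := (le_max_of_le_left (by positivity)).trans_lt hN
  obtain ⟨q, hq, hqN, p, hp⟩ := exists_simultaneous_approx ξ (Nat.cast_pos.1 hN')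
  have hq1 : (1 : ℝ) ≤ q := by exact_mod_cast hq
  rw [max_lt_iff] at hN
  by_cases hcase : q * L n₀ ≤ 1 / 4
  · refine key N q n₀ p hp hcase ?_ ?_
    · rw [div_lt_iff₀ hN']; linarith
    · have : s * b n₀ / N < L n₀ := by
        rw [div_lt_iff₀ hN']
        rw [div_lt_iff₀ (hL _)] at hN
        linarith
      nlinarith [hL n₀]
  · have hex : ∃ k, q * L (n₀ + k) ≤ 1 / 4 := by
      have h := hLlim.const_mul (q : ℝ)
      rw [mul_zero] at h
      obtain ⟨m, hm⟩ := eventually_atTop.1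
        (h.eventually_le_const (show (0 : ℝ) < 1 / 4 by norm_num))
      exact ⟨m, hm _ (Nat.le_add_left _ _)⟩
    classical
    obtain ⟨k, hk, hk'⟩ : ∃ k, ¬ q * L (n₀ + k) ≤ 1 / 4 ∧ q * L (n₀ + k + 1) ≤ 1 / 4 := by
      have hpos : Nat.find hex ≠ 0 := fun h ↦ hcase ((Nat.find_eq_zero hex).1 h)
      obtain ⟨k, hk⟩ := Nat.exists_eq_succ_of_ne_zero hpos
      refine ⟨k, Nat.find_min hex (by omega), ?_⟩
      have := Nat.find_spec hex
      rwa [hk] at this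
    set n := n₀ + k
    rw [not_le] at hk
    have hbM : 1 ≤ b (n + 1) * M n := one_le_mul_of_one_le_of_one_le (hb _) (hM _)
    have hlt : 4 * s * (b (n + 1) * M n) < N := by
      refine lt_of_pow_lt_pow_left₀ s hN'.le ?_
      have h1 := hn₀ n (Nat.le_add_right _ _)
      have h2 : (q : ℝ) ≤ (N : ℝ) ^ s := by exact_mod_cast hqN
      have h3 : 1 < (N : ℝ) ^ s * (4 * L n) := by nlinarith [hL n]
      have h4 : 0 < 4 * L n := by linarith [hL n]
      exact lt_of_mul_lt_mul_right (h1.trans h3) h4.le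
    have hM0 : 0 < M n := zero_lt_one.trans_le (hM n)
    have h5 : s * b (n + 1) / N < 1 / (4 * M n) := by
      rw [div_lt_div_iff₀ hN' (by positivity)]
      linarith
    have h6 : 1 / (4 * M n) ≤ 1 / 4 := by
      gcongr
      linarith [hM n]
    have h7 : 1 / (4 * M n) ≤ q * L (n + 1) := by
      rw [div_le_iff₀ (by positivity)]
      have := mul_le_mul_of_nonneg_left (hratio n) (zero_le_one.trans hq1)
      nlinarith
    exact key N q (n + 1) p hp hk' (h5.trans_le h6) (h5.trans_le h7)

theorem lt_finrank_of_small_forms {V : Submodule ℚ ℝ} [FiniteDimensional ℚ V] {ι : Type*}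
    [Fintype ι] {x : ι → ℝ} (hx : ∀ i, x i ∈ V) {s : ℕ} (L : ℕ → ℝ) (l : ℕ → ι → ℤ)
    (b M : ℕ → ℝ) (hL : ∀ n, 0 < L n) (hform : ∀ n, L n = ∑ i, l n i * x i)
    (hl : ∀ n i, |(l n i : ℝ)| ≤ b n) (hb : ∀ n, 1 ≤ b n) (hM : ∀ n, 1 ≤ M n)
    (hratio : ∀ n, L n ≤ M n * L (n + 1))
    (hlim : Tendsto (fun n ↦ (b (n + 1) * M n) ^ s * L n) atTop (𝓝 0)) :
    s + 1 < Module.finrank ℚ V := by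
  by_contra! hd
  obtain ⟨t, ht⟩ : ∃ t, Module.finrank ℚ V = t + 1 := by
    refine Nat.exists_eq_succ_of_ne_zero fun h0 ↦ (hL 0).ne' ?_
    have hV : V = ⊥ := Submodule.finrank_eq_zero.1 h0
    rw [hform, sum_eq_zero]
    intro i _
    have := hx i
    rw [hV, Submodule.mem_bot] at this
    rw [this, mul_zero]
  let e := (Module.finBasis ℚ V).reindex (finCongr ht)
  obtain ⟨D, hD⟩ := IsLocalization.exist_integer_multiples_of_finite (nonZeroDivisors ℤ)
    (fun ij : ι × Fin (t + 1) ↦ e.repr ⟨x ij.1, hx ij.1⟩ ij.2)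
  have hD0 : ((D : ℤ) : ℝ) ≠ 0 := Int.cast_ne_zero.2 (nonZeroDivisors.coe_ne_zero D)
  choose m hm using hD
  have hm' (i : ι) (j : Fin (t + 1)) : (m (i, j) : ℝ) = (D : ℤ) * (e.repr ⟨x i, hx i⟩ j : ℚ) := by
    have h : (m (i, j) : ℚ) = (D : ℤ) • e.repr ⟨x i, hx i⟩ j := hm (i, j)
    rw [zsmul_eq_mul] at h
    exact_mod_cast congrArg (fun q : ℚ ↦ (q : ℝ)) h
  have hDx (i : ι) : (D : ℤ) * x i = ∑ j, (m (i, j) : ℝ) * e j := by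
    have h := congrArg (fun v : V ↦ (v : ℝ)) (e.sum_repr ⟨x i, hx i⟩)
    simp only [Submodule.coe_sum, Submodule.coe_smul, Rat.smul_def] at h
    rw [← h, mul_sum]
    exact sum_congr rfl fun j _ ↦ by rw [hm', mul_assoc]
  have he0 : (e 0 : ℝ) ≠ 0 := fun h ↦ e.ne_zero 0 (Subtype.ext h)
  have hr0 : ((D : ℤ) / e 0 : ℝ) ≠ 0 := div_ne_zero hD0 he0
  obtain ⟨ε, hε, hε1⟩ : ∃ ε : ℤ, |((D : ℤ) / e 0 : ℝ)| = ε * ((D : ℤ) / e 0) ∧ |(ε : ℝ)| = 1 := by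
    rcases abs_choice ((D : ℤ) / e 0 : ℝ) with h | h
    · exact ⟨1, by rw [h]; simp, by simp⟩
    · exact ⟨-1, by rw [h]; simp, by simp⟩
  set r := |((D : ℤ) / e 0 : ℝ)|
  have hr : 0 < r := abs_pos.2 hr0
  let c (n : ℕ) (j : Fin (t + 1)) : ℤ := ε * ∑ i, l n i * m (i, j)
  have hLr (n : ℕ) : r * L n = ∑ j, (c n j : ℝ) * (e j / e 0) := by
    calc r * L n = ε * (1 / e 0) * ∑ i, l n i * ((D : ℤ) * x i) := by
          rw [hε, hform, mul_sum, mul_sum]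
          exact sum_congr rfl fun i _ ↦ by ring
      _ = ε * (1 / e 0) * ∑ j, ∑ i, (l n i : ℝ) * ((m (i, j) : ℝ) * (e j : ℝ)) := by
          rw [sum_comm]
          simp only [hDx, mul_sum]
      _ = _ := by
          simp only [c]
          push_cast
          simp only [mul_sum, sum_mul]
          exact sum_congr rfl fun j _ ↦ sum_congr rfl fun i _ ↦ by ring
  set K : ℝ := 1 + ∑ i, ∑ j, |(m (i, j) : ℝ)|
  have hK : 1 ≤ K := le_add_of_nonneg_right (by positivity)
  have hc (n : ℕ) (j : Fin (t + 1)) : |(c n j : ℝ)| ≤ K * b n := by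
    have hbn : 0 ≤ b n := zero_le_one.trans (hb n)
    calc |(c n j : ℝ)| = |∑ i, (l n i : ℝ) * m (i, j)| := by
          simp only [c]
          push_cast
          rw [abs_mul, hε1, one_mul]
      _ ≤ ∑ i, |(l n i : ℝ) * m (i, j)| := abs_sum_le_sum_abs _ _
      _ ≤ ∑ i, b n * ∑ j, |(m (i, j) : ℝ)| := by
          refine sum_le_sum fun i _ ↦ ?_
          rw [abs_mul]
          exact mul_le_mul (hl n i) (single_le_sum (f := fun j ↦ |(m (i, j) : ℝ)|)
            (fun _ _ ↦ abs_nonneg _) (mem_univ j)) (abs_nonneg _) hbn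
      _ ≤ K * b n := by rw [← mul_sum, mul_comm]; gcongr; simp [K]
  refine nesterenko_criterion (s := t) (fun j ↦ e j.succ / e 0) (fun n ↦ r * L n) (fun n ↦ c n 0)
    (fun n j ↦ c n j.succ) (fun n ↦ K * b n) M (fun n ↦ mul_pos hr (hL n)) (fun n ↦ ?_)
    (fun n j ↦ hc n _) (fun n ↦ one_le_mul_of_one_le_of_one_le hK (hb n)) hM (fun n ↦ ?_) ?_
  · rw [hLr, Fin.sum_univ_succ, div_self he0, mul_one]
  · have := mul_le_mul_of_nonneg_left (hratio n) hr.le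
    linarith
  · have h := hlim.const_mul (K ^ t * r)
    rw [mul_zero] at h
    refine squeeze_zero (fun n ↦ ?_) (fun n ↦ ?_) h
    · have := hL n
      have := hb (n + 1)
      have := hM n
      positivity
    · have hbM : 1 ≤ b (n + 1) * M n := one_le_mul_of_one_le_of_one_le (hb _) (hM _)
      calc (K * b (n + 1) * M n) ^ t * (r * L n)
          = K ^ t * r * ((b (n + 1) * M n) ^ t * L n) := by simp only [mul_pow]; ring
        _ ≤ K ^ t * r * ((b (n + 1) * M n) ^ s * L n) := by
            have := hL n
            gcongr
            omega

/-- `f` has a partial fraction decomposition with poles of order at most `m` at `0, -1, …, -n`,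
such that the coefficients of the poles of order `i + 1` become integers after multiplication
by `d ^ (m - 1 - i)` and the absolute values of all coefficients add up to at most `B`. -/
def HasPartialFractions (n d m : ℕ) (B : ℝ) (f : ℝ → ℝ) : Prop :=
  ∃ c : ℕ → ℕ → ℝ,
    (∀ t : ℝ, (∀ j ≤ n, t + j ≠ 0) →
      f t = ∑ i ∈ range m, ∑ j ∈ range (n + 1), c i j / (t + j) ^ (i + 1)) ∧
    (∀ i < m, ∀ j ≤ n, ∃ z : ℤ, (d : ℝ) ^ (m - 1 - i) * c i j = z) ∧
    ∑ i ∈ range m, ∑ j ∈ range (n + 1), |c i j| ≤ B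

namespace HasPartialFractions

variable {n d m : ℕ} {B B' : ℝ} {f g : ℝ → ℝ}

theorem congr (hf : HasPartialFractions n d m B f)
    (h : ∀ t : ℝ, (∀ j ≤ n, t + j ≠ 0) → g t = f t) : HasPartialFractions n d m B g := by
  obtain ⟨c, h1, h2, h3⟩ := hf
  exact ⟨c, fun t ht ↦ (h t ht).trans (h1 t ht), h2, h3⟩

theorem mono (hf : HasPartialFractions n d m B f) (h : B ≤ B') :
    HasPartialFractions n d m B' f := by
  obtain ⟨c, h1, h2, h3⟩ := hf
  exact ⟨c, h1, h2, h3.trans h⟩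

theorem zero : HasPartialFractions n d m 0 (fun _ ↦ 0) :=
  ⟨fun _ _ ↦ 0, by simp, fun _ _ _ _ ↦ ⟨0, by simp⟩, by simp⟩

theorem add (hf : HasPartialFractions n d m B f) (hg : HasPartialFractions n d m B' g) :
    HasPartialFractions n d m (B + B') (fun t ↦ f t + g t) := by
  obtain ⟨c, h1, h2, h3⟩ := hf
  obtain ⟨c', h1', h2', h3'⟩ := hg
  refine ⟨fun i j ↦ c i j + c' i j, fun t ht ↦ ?_, fun i hi j hj ↦ ?_, ?_⟩
  · simp only [h1 t ht, h1' t ht, add_div, sum_add_distrib]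
  · obtain ⟨z, hz⟩ := h2 i hi j hj
    obtain ⟨z', hz'⟩ := h2' i hi j hj
    exact ⟨z + z', by rw [mul_add, hz, hz']; push_cast; rfl⟩
  · refine le_trans ?_ (add_le_add h3 h3')
    simp only [← sum_add_distrib]
    exact sum_le_sum fun i _ ↦ sum_le_sum fun j _ ↦ abs_add_le _ _

theorem sum {ι : Type*} (s : Finset ι) {B : ι → ℝ} {f : ι → ℝ → ℝ}
    (h : ∀ i ∈ s, HasPartialFractions n d m (B i) (f i)) :
    HasPartialFractions n d m (∑ i ∈ s, B i) (fun t ↦ ∑ i ∈ s, f i t) := by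
  classical
  induction s using Finset.induction_on with
  | empty => simpa using zero
  | insert a s ha ih =>
    simp only [sum_insert ha]
    exact (h a (mem_insert_self _ _)).add (ih fun i hi ↦ h i (mem_insert_of_mem hi))

theorem single {i j : ℕ} (hi : i < m) (hj : j ≤ n) {c : ℝ}
    (hc : ∃ z : ℤ, (d : ℝ) ^ (m - 1 - i) * c = z) :
    HasPartialFractions n d m |c| (fun t ↦ c / (t + j) ^ (i + 1)) := by
  have hj' : j ∈ range (n + 1) := mem_range.2 (by omega)
  refine ⟨fun i' j' ↦ if i' = i ∧ j' = j then c else 0, fun t _ ↦ ?_, fun i' _ j' _ ↦ ?_, ?_⟩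
  · rw [sum_eq_single_of_mem i (mem_range.2 hi), sum_eq_single_of_mem j hj']
    · simp
    · intro b _ hb; simp [hb]
    · intro b _ hb; simp [hb]
  · beta_reduce
    split_ifs with h
    · rw [h.1]; exact hc
    · exact ⟨0, by simp⟩
  · rw [sum_eq_single_of_mem i (mem_range.2 hi), sum_eq_single_of_mem j hj']
    · simp
    · intro b _ hb; simp [hb]
    · intro b _ hb; simp [hb]

theorem single_div {j k : ℕ} (hd : ∀ x, 1 ≤ x → x ≤ n → x ∣ d) (hj : j ≤ n) (hk : k ≤ n)
    (hjk : j ≠ k) (i : ℕ) : ∀ m, i < m → ∀ c : ℝ, (∃ z : ℤ, (d : ℝ) ^ (m - 1 - i) * c = z) →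
    HasPartialFractions n d (m + 1) ((i + 2) * |c|) (fun t ↦ c / (t + j) ^ (i + 1) / (t + k)) := by
  have hkj : ((k : ℝ) - j) ≠ 0 := sub_ne_zero.2 (by exact_mod_cast hjk.symm)
  obtain ⟨e, he⟩ : ∃ e : ℝ, e = 1 / ((k : ℝ) - j) := ⟨_, rfl⟩
  have hde : ∃ z : ℤ, d * e = z := by
    rcases lt_or_gt_of_ne hjk with h | h
    · obtain ⟨y, hy⟩ := hd (k - j) (by omega) (by omega)
      refine ⟨y, ?_⟩
      rw [he, hy, Nat.cast_mul, Nat.cast_sub h.le]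
      push_cast
      field_simp
    · obtain ⟨y, hy⟩ := hd (j - k) (by omega) (by omega)
      refine ⟨-y, ?_⟩
      rw [he, hy, Nat.cast_mul, Nat.cast_sub h.le]
      push_cast
      field_simp
      ring
  have he1 : |e| ≤ 1 := by
    rw [he, abs_div, abs_one]
    refine div_le_one_of_le₀ ?_ (abs_nonneg _)
    have h : (1 : ℤ) ≤ |(k : ℤ) - j| := Int.one_le_abs (by omega)
    exact_mod_cast h
  have hce (c : ℝ) : |c * e| ≤ |c| := by
    rw [abs_mul]; exact mul_le_of_le_one_right (abs_nonneg _) he1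
  have hsplit (t : ℝ) (ht : ∀ j ≤ n, t + j ≠ 0) :
      1 / (t + j) / (t + k) = e / (t + j) - e / (t + k) := by
    have h1 := ht j hj
    have h2 := ht k hk
    rw [he]
    field_simp
    ring
  induction i with
  | zero =>
    intro m hm c ⟨z, hz⟩
    obtain ⟨y, hy⟩ := hde
    have hint : (d : ℝ) ^ (m + 1 - 1 - 0) * (c * e) = (z * y : ℤ) := by
      obtain ⟨m', rfl⟩ := Nat.exists_eq_succ_of_ne_zero hm.ne'
      push_cast
      rw [← hz, ← hy]
      simp only [Nat.add_sub_cancel, Nat.sub_zero, Nat.succ_eq_add_one, pow_succ]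
      ring
    have h1 := single (m := m + 1) (i := 0) (Nat.succ_pos m) hj ⟨_, hint⟩
    have h2 := single (m := m + 1) (i := 0) (c := -(c * e)) (Nat.succ_pos m) hk
      ⟨-(z * y), by rw [mul_neg, hint]; push_cast; ring⟩
    refine ((h1.add h2).congr fun t ht ↦ ?_).mono ?_
    · have := hsplit t ht
      simp only [zero_add, pow_one]
      calc c / (t + j) / (t + k) = c * (1 / (t + j) / (t + k)) := by ring
        _ = _ := by rw [this]; ring
    · rw [abs_neg]
      have := hce c
      push_cast
      linarith
  | succ i ih =>
    intro m hm c ⟨z, hz⟩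
    obtain ⟨y, hy⟩ := hde
    have hint : (d : ℝ) ^ (m - 1 - i) * (c * e) = (z * y : ℤ) := by
      rw [show m - 1 - i = (m - 1 - (i + 1)) + 1 by omega, pow_succ]
      push_cast
      rw [← hz, ← hy]
      ring
    have h1 := single (m := m + 1) (i := i + 1) (by omega) hj (c := c * e)
      ⟨z * y, by rw [← hint]; congr 2; omega⟩
    have h2 := ih m (by omega) (-(c * e)) ⟨-(z * y), by rw [mul_neg, hint]; push_cast; ring⟩
    refine ((h1.add h2).congr fun t ht ↦ ?_).mono ?_
    · have := hsplit t ht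
      calc c / (t + j) ^ (i + 1 + 1) / (t + k)
          = c / (t + j) ^ (i + 1) * (1 / (t + j) / (t + k)) := by
            rw [pow_succ (t + (j : ℝ)) (i + 1)]; field_simp
        _ = _ := by rw [this, pow_succ (t + (j : ℝ)) (i + 1)]; field_simp; ring
    · rw [abs_neg]
      have h := hce c
      have : ((i : ℝ) + 2) * |c * e| ≤ (i + 2) * |c| := by gcongr
      push_cast
      linarith

theorem mul (hd : ∀ x, 1 ≤ x → x ≤ n → x ∣ d) (hf : HasPartialFractions n d m (m.factorial * B) f)
    (hg : HasPartialFractions n d 1 B' g) :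
    HasPartialFractions n d (m + 1) ((m + 1).factorial * (B * B')) (fun t ↦ f t * g t) := by
  obtain ⟨c, h1, h2, h3⟩ := hf
  obtain ⟨c', h1', h2', h3'⟩ := hg
  have key : ∀ i ∈ range m, ∀ j ∈ range (n + 1), ∀ k ∈ range (n + 1),
      HasPartialFractions n d (m + 1) ((m + 1) * (|c i j| * |c' 0 k|))
        (fun t ↦ c i j / (t + j) ^ (i + 1) * (c' 0 k / (t + k))) := by
    intro i hi j hj k hk
    rw [mem_range] at hi hj hk
    obtain ⟨z, hz⟩ := h2 i hi j (by omega)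
    obtain ⟨z', hz'⟩ := h2' 0 one_pos k (by omega)
    simp only [Nat.sub_self, pow_zero, one_mul] at hz'
    have hint : (d : ℝ) ^ (m - 1 - i) * (c i j * c' 0 k) = (z * z' : ℤ) := by
      rw [← mul_assoc, hz, hz']; push_cast; rfl
    rw [← abs_mul]
    rcases eq_or_ne j k with rfl | hjk
    · refine ((single (m := m + 1) (i := i + 1) (c := c i j * c' 0 j) (by omega)
        (Nat.lt_succ_iff.1 hj) ⟨z * z', ?_⟩).congr fun t _ ↦ ?_).mono ?_
      · rw [← hint]; congr 2; omega
      · rw [div_mul_div_comm, ← pow_succ]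
      · exact le_mul_of_one_le_left (abs_nonneg _) (by linarith [(Nat.cast_nonneg m : (0:ℝ) ≤ m)])
    · refine ((single_div hd (Nat.lt_succ_iff.1 hj) (Nat.lt_succ_iff.1 hk) hjk i m hi _
        ⟨_, hint⟩).congr fun t _ ↦ ?_).mono ?_
      · rw [div_mul_div_comm, div_div]
      · gcongr ?_ * _
        have : (i : ℝ) + 1 ≤ m := by exact_mod_cast hi
        linarith
  have hsum := sum _ fun i hi ↦ sum _ fun j hj ↦ sum _ fun k hk ↦ key i hi j hj k hk
  refine (hsum.congr fun t ht ↦ ?_).mono ?_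
  · rw [h1 t ht, h1' t ht]
    simp only [sum_range_one, zero_add, pow_one]
    rw [sum_mul]
    refine sum_congr rfl fun i _ ↦ ?_
    rw [sum_mul]
    refine sum_congr rfl fun j _ ↦ ?_
    rw [mul_sum]
  · rw [sum_range_one] at h3'
    simp only [← mul_sum, ← sum_mul]
    have h0 : 0 ≤ ∑ j ∈ range (n + 1), |c' 0 j| := sum_nonneg fun _ _ ↦ abs_nonneg _
    have h0' : 0 ≤ ∑ i ∈ range m, ∑ j ∈ range (n + 1), |c i j| :=
      sum_nonneg fun _ _ ↦ sum_nonneg fun _ _ ↦ abs_nonneg _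
    calc _ ≤ (m + 1 : ℝ) * (m.factorial * B * B') := by
          gcongr
          exact h0'.trans h3
      _ = _ := by rw [Nat.factorial_succ]; push_cast; ring

theorem pow (hd : ∀ x, 1 ≤ x → x ≤ n → x ∣ d) (hf : HasPartialFractions n d 1 B f) (k : ℕ) :
    HasPartialFractions n d (k + 1) ((k + 1).factorial * B ^ (k + 1)) (fun t ↦ f t ^ (k + 1)) := by
  induction k with
  | zero => simpa using hf
  | succ k ih => simpa only [pow_succ _ (k + 1)] using ih.mul hd hf

theorem mul_prod {B : ℕ → ℝ} {g : ℕ → ℝ → ℝ} {B₀ : ℝ} (hd : ∀ x, 1 ≤ x → x ≤ n → x ∣ d)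
    (hf : HasPartialFractions n d m (m.factorial * B₀) f)
    (hg : ∀ l, HasPartialFractions n d 1 (B l) (g l)) (k : ℕ) :
    HasPartialFractions n d (m + k) ((m + k).factorial * (B₀ * ∏ l ∈ range k, B l))
      (fun t ↦ f t * ∏ l ∈ range k, g l t) := by
  induction k with
  | zero => simpa using hf
  | succ k ih => simpa only [prod_range_succ, mul_assoc, ← add_assoc] using ih.mul hd (hg k)

theorem of_polynomial {P : Polynomial ℝ} (hP : P.natDegree ≤ n) {z : ℕ → ℤ} {Z : ℝ}
    (hz : ∀ k ≤ n, P.eval (-(k : ℝ)) = n.factorial * z k) (hZ : ∀ k ≤ n, |(z k : ℝ)| ≤ Z) :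
    HasPartialFractions n d 1 (2 ^ n * Z) (fun t ↦ P.eval t / ∏ j ∈ range (n + 1), (t + j)) := by
  have hinj : Set.InjOn (fun k : ℕ ↦ -(k : ℝ)) (range (n + 1)) := fun x _ y _ h ↦ by simpa using h
  have hw (k : ℕ) (hk : k ≤ n) : Lagrange.nodalWeight (range (n + 1)) (fun k : ℕ ↦ -(k : ℝ)) k
      * (n.factorial * z k) = ((-1) ^ k * n.choose k * z k : ℤ) := by
    have h1 : ∏ j ∈ (range (n + 1)).erase k, (-(k : ℝ) - -(j : ℝ))
        = (-1) ^ k * (k.factorial * (n - k).factorial) := by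
      have hsplit : (range (n + 1)).erase k = range k ∪ Ico (k + 1) (n + 1) := by
        ext x; simp only [mem_erase, mem_range, mem_union, mem_Ico]; omega
      rw [hsplit, prod_union]
      swap
      · rw [disjoint_left]; intro x; simp only [mem_range, mem_Ico]; omega
      rw [prod_Ico_eq_prod_range, ← prod_range_reflect, ← mul_assoc]
      congr 1
      · rw [← prod_range_add_one_eq_factorial, Nat.cast_prod, ← card_range k, ← prod_const,
          card_range, ← prod_mul_distrib]
        refine prod_congr rfl fun x hx ↦ ?_
        rw [mem_range] at hx
        rw [Nat.cast_sub (by omega), Nat.cast_sub (by omega)]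
        push_cast
        ring
      · rw [← prod_range_add_one_eq_factorial, Nat.cast_prod, show n + 1 - (k + 1) = n - k by omega]
        refine prod_congr rfl fun x hx ↦ ?_
        push_cast
        ring
    rw [Lagrange.nodalWeight, prod_inv_distrib, h1]
    have h2 : ((n.choose k * k.factorial * (n - k).factorial : ℕ) : ℝ) = (n.factorial : ℝ) := by
      rw [Nat.choose_mul_factorial_mul_factorial hk]
    rw [← h2]
    have h3 : (k.factorial : ℝ) ≠ 0 := Nat.cast_ne_zero.2 (Nat.factorial_ne_zero _)
    have h4 : ((n - k).factorial : ℝ) ≠ 0 := Nat.cast_ne_zero.2 (Nat.factorial_ne_zero _)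
    have h5 : ((-1 : ℝ) ^ k) * (-1) ^ k = 1 := by rw [← mul_pow]; simp
    have h6 : ((-1 : ℝ) ^ k) ≠ 0 := by positivity
    push_cast
    field_simp
    rw [← pow_mul, mul_comm k, pow_mul]
    simp
  refine ⟨fun _ k ↦ (((-1) ^ k * n.choose k * z k : ℤ) : ℝ), fun t ht ↦ ?_, fun _ _ k _ ↦
    ⟨(-1) ^ k * n.choose k * z k, by rw [Nat.sub_self, Nat.zero_sub, pow_zero, one_mul]⟩, ?_⟩
  · have hdeg : P.degree < (#(range (n + 1)) : ℕ) := by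
      rw [card_range]
      exact (Polynomial.degree_le_natDegree).trans_lt (by exact_mod_cast Nat.lt_succ_of_le hP)
    have hne : ∀ i ∈ range (n + 1), t ≠ -(i : ℝ) := fun i hi h ↦
      ht i (Nat.lt_succ_iff.1 (mem_range.1 hi)) (by rw [h]; ring)
    conv_lhs => rw [Lagrange.eq_interpolate hinj hdeg]
    beta_reduce
    rw [Lagrange.eval_interpolate_not_at_node _ hne, Lagrange.eval_nodal, sum_range_one]
    have hprod : ∏ j ∈ range (n + 1), (t + (j : ℝ)) ≠ 0 :=
      prod_ne_zero_iff.2 fun j hj ↦ ht j (Nat.lt_succ_iff.1 (mem_range.1 hj))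
    simp only [sub_neg_eq_add]
    rw [mul_div_cancel_left₀ _ hprod]
    refine sum_congr rfl fun k hk ↦ ?_
    have hk' := Nat.lt_succ_iff.1 (mem_range.1 hk)
    rw [hz k hk', ← hw k hk', zero_add, pow_one]
    ring
  · rw [sum_range_one]
    have h2 : ((2 : ℝ) ^ n) = ∑ k ∈ range (n + 1), (n.choose k : ℝ) := by
      exact_mod_cast (Nat.sum_range_choose n).symm
    rw [h2, sum_mul]
    refine sum_le_sum fun k hk ↦ ?_
    push_cast
    rw [abs_mul, abs_mul, abs_pow, abs_neg, abs_one, one_pow, one_mul, Nat.abs_cast]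
    exact mul_le_mul_of_nonneg_left (hZ k (Nat.lt_succ_iff.1 (mem_range.1 hk))) (Nat.cast_nonneg _)

end HasPartialFractions

theorem prod_range_prod_range_mul_add (f : ℕ → ℝ) (r n : ℕ) :
    ∏ l ∈ range r, ∏ i ∈ range n, f (l * n + i) = ∏ i ∈ range (r * n), f i := by
  induction r with
  | zero => simp
  | succ r ih => rw [prod_range_succ, ih, add_one_mul, prod_range_add]

theorem prod_choose_le (r n : ℕ) :
    ∏ l ∈ range r, ((l + 2) * n).choose n ≤ (r + 1) ^ ((r + 1) * n) := by
  induction r with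
  | zero => simp
  | succ r ih =>
    rw [prod_range_succ, mul_comm]
    have h := choose_mul_pow_mul_pow_le 1 (r + 1) ((r + 2) * n) n
      (Nat.le_mul_of_pos_left n (by omega))
    rw [one_pow, one_mul, show (r + 2) * n - n = (r + 1) * n by
      rw [show r + 2 = (r + 1) + 1 by rfl, add_one_mul (r + 1) n, Nat.add_sub_cancel],
      show 1 + (r + 1) = r + 1 + 1 by ring] at h
    exact (Nat.mul_le_mul_left _ ih).trans h

/-- The rational function of Ball and Rivoal. -/
noncomputable def ballRivoal (a r n : ℕ) (t : ℝ) : ℝ :=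
  n.factorial ^ (a - 2 * r) * (∏ i ∈ range (r * n), (t - (i + 1))) *
    (∏ i ∈ range (r * n), (t + n + (i + 1))) / (∏ j ∈ range (n + 1), (t + j)) ^ a

theorem prod_add_eq_factorial_mul_choose (k n : ℕ) :
    ∏ i ∈ range n, ((k : ℝ) + (i + 1)) = n.factorial * (k + n).choose n := by
  rw [← Nat.cast_mul, ← Nat.ascFactorial_eq_factorial_mul_choose, Nat.ascFactorial_eq_prod_range,
    Nat.cast_prod]
  refine prod_congr rfl fun i _ ↦ ?_
  push_cast
  ring

theorem hasPartialFractions_ballRivoal {a r n d : ℕ} (hd : ∀ x, 1 ≤ x → x ≤ n → x ∣ d)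
    (har : 2 * r < a) :
    HasPartialFractions n d a (a.factorial * (2 ^ a * (r + 1) ^ (2 * r + 2)) ^ n)
      (ballRivoal a r n) := by
  obtain ⟨q, rfl⟩ : ∃ q, a = q + 1 + r + r := ⟨a - 2 * r - 1, by omega⟩
  have h0 : HasPartialFractions n d 1 (2 ^ n * 1)
      (fun t ↦ (Polynomial.C (n.factorial : ℝ)).eval t / ∏ j ∈ range (n + 1), (t + j)) :=
    .of_polynomial (z := fun _ ↦ 1) (by simp) (by simp) (by simp)
  have hg (l : ℕ) : HasPartialFractions n d 1 (2 ^ n * ((l + 2) * n).choose n)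
      (fun t ↦ (∏ i ∈ range n, (Polynomial.X - Polynomial.C (((l * n + i : ℕ) : ℝ) + 1))).eval t /
        ∏ j ∈ range (n + 1), (t + j)) := by
    refine .of_polynomial (z := fun k ↦ (-1) ^ n * (k + l * n + n).choose n) ?_
      (fun k hk ↦ ?_) fun k hk ↦ ?_
    · refine (Polynomial.natDegree_prod_le _ _).trans (le_of_eq ?_)
      simp only [Polynomial.natDegree_X_sub_C, sum_const, card_range, smul_eq_mul, mul_one]
    · rw [Polynomial.eval_prod]
      simp only [Polynomial.eval_sub, Polynomial.eval_X, Polynomial.eval_C]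
      have h := prod_add_eq_factorial_mul_choose (k + l * n) n
      push_cast
      rw [mul_left_comm, ← h, ← card_range n, ← prod_const, card_range, ← prod_mul_distrib]
      refine prod_congr rfl fun i _ ↦ ?_
      push_cast
      ring
    · push_cast
      rw [abs_mul, abs_pow, abs_neg, abs_one, one_pow, one_mul, Nat.abs_cast, Nat.cast_le]
      exact Nat.choose_le_choose _ (by linarith [add_mul l 2 n])
  have hh (l : ℕ) : HasPartialFractions n d 1 (2 ^ n * ((l + 2) * n).choose n)
      (fun t ↦ (∏ i ∈ range n, (Polynomial.X + Polynomial.C ((n : ℝ) + (((l * n + i : ℕ) : ℝ) + 1)))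
        ).eval t / ∏ j ∈ range (n + 1), (t + j)) := by
    refine .of_polynomial (z := fun k ↦ (n - k + l * n + n).choose n) ?_
      (fun k hk ↦ ?_) fun k hk ↦ ?_
    · refine (Polynomial.natDegree_prod_le _ _).trans (le_of_eq ?_)
      simp only [Polynomial.natDegree_X_add_C, sum_const, card_range, smul_eq_mul, mul_one]
    · rw [Polynomial.eval_prod]
      simp only [Polynomial.eval_add, Polynomial.eval_X, Polynomial.eval_C]
      have h := prod_add_eq_factorial_mul_choose (n - k + l * n) n
      rw [Int.cast_natCast, ← h]
      refine prod_congr rfl fun i _ ↦ ?_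
      push_cast [Nat.cast_sub hk]
      ring
    · push_cast
      rw [Nat.abs_cast, Nat.cast_le]
      exact Nat.choose_le_choose _ (by rw [add_mul]; omega)
  have h := (((h0.pow hd q).mul_prod hd hg r).congr (fun _ _ ↦ rfl)).mono
    (B' := (q + 1 + r).factorial * ((2 ^ n * 1) ^ (q + 1) *
      ∏ l ∈ range r, ((2 : ℝ) ^ n * ((l + 2) * n).choose n))) le_rfl
  refine ((h.mul_prod hd hh r).congr fun t _ ↦ ?_).mono ?_
  · simp only [prod_div_distrib, prod_const, card_range, Polynomial.eval_prod, Polynomial.eval_sub,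
      Polynomial.eval_add, Polynomial.eval_X, Polynomial.eval_C]
    rw [prod_range_prod_range_mul_add (fun i ↦ t - ((i : ℝ) + 1)),
      prod_range_prod_range_mul_add (fun i ↦ t + ((n : ℝ) + ((i : ℝ) + 1))), ballRivoal,
      show q + 1 + r + r - 2 * r = q + 1 by omega]
    simp only [add_assoc t]
    rw [div_pow, div_mul_div_comm, div_mul_div_comm, pow_add _ (q + 1 + r), pow_add _ (q + 1)]
  · have h1 : ∏ l ∈ range r, ((2 : ℝ) ^ n * ((l + 2) * n).choose n)
        ≤ (2 ^ n) ^ r * (r + 1) ^ ((r + 1) * n) := by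
      rw [prod_mul_distrib, prod_const, card_range]
      gcongr
      exact_mod_cast prod_choose_le r n
    have h0 : 0 ≤ ∏ l ∈ range r, ((2 : ℝ) ^ n * ((l + 2) * n).choose n) := by positivity
    gcongr
    calc _ ≤ (2 ^ n * 1) ^ (q + 1) * ((2 ^ n) ^ r * ((r : ℝ) + 1) ^ ((r + 1) * n)) *
          ((2 ^ n) ^ r * (r + 1) ^ ((r + 1) * n)) := by gcongr
      _ = _ := by
        generalize (r : ℝ) + 1 = x
        rw [mul_pow (2 ^ (q + 1 + r + r)), ← pow_mul, ← pow_mul]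
        ring

/-- The real number multiplied by the coefficient of `some i` in the linear forms: the zeta value
at `i + 1` if this is an odd integer at least `3`, and `0` otherwise; `none` stands for `1`. -/
noncomputable def zetaVector (a : ℕ) : Option (Fin a) → ℝ
  | none => 1
  | some i => if Even (i : ℕ) ∧ (i : ℕ) ≠ 0 then zetaR (i + 1) else 0

theorem tendsto_one_div_nat_add_pow (p j : ℕ) :
    Tendsto (fun u : ℕ ↦ 1 / ((u : ℝ) + j + 1) ^ (p + 1)) atTop (𝓝 0) := by
  have h : Tendsto (fun u : ℕ ↦ (u : ℝ) + j + 1) atTop atTop :=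
    tendsto_atTop_add_const_right _ _ (tendsto_atTop_add_const_right _ _
      tendsto_natCast_atTop_atTop)
  have h2 := ((tendsto_pow_atTop (Nat.succ_ne_zero p)).comp h).inv_tendsto_atTop
  refine h2.congr fun u ↦ ?_
  simp

theorem tendsto_sum_shift_sub {g : ℕ → ℝ} (hg : Tendsto g atTop (𝓝 0)) (j : ℕ) :
    Tendsto (fun N ↦ ∑ u ∈ range N, g (u + j) - ∑ u ∈ range N, g u) atTop
      (𝓝 (-∑ u ∈ range j, g u)) := by
  have h : Tendsto (fun N ↦ ∑ u ∈ range j, g (N + u) - ∑ u ∈ range j, g u) atTop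
      (𝓝 (∑ u ∈ range j, 0 - ∑ u ∈ range j, g u)) :=
    (tendsto_finsetSum _ fun u _ ↦ hg.comp (tendsto_add_atTop_nat u)).sub_const _
  rw [sum_const_zero, zero_sub] at h
  refine h.congr fun N ↦ ?_
  have h1 := sum_range_add g N j
  have h2 := sum_range_add g j N
  rw [add_comm j N] at h2
  simp only [add_comm j] at h2
  linarith

theorem HasPartialFractions.symmetrize {n d a : ℕ} {B : ℝ} {f : ℝ → ℝ}
    (hf : HasPartialFractions n d a B f)
    (hsymm : ∀ t, (∀ j ≤ n, t + (j : ℝ) ≠ 0) → f (-n - t) = -f t) :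
    ∃ c : ℕ → ℕ → ℝ,
      (∀ t : ℝ, (∀ j ≤ n, t + j ≠ 0) →
        2 * f t = ∑ i ∈ range a, ∑ j ∈ range (n + 1), c i j / (t + j) ^ (i + 1)) ∧
      (∀ i < a, ∀ j ≤ n, (d : ℝ) ^ (a - 1 - i) * c i j ∈ (Int.castRingHom ℝ).range) ∧
      ∑ i ∈ range a, ∑ j ∈ range (n + 1), |c i j| ≤ 2 * B ∧
      ∀ i, Odd i → ∑ j ∈ range (n + 1), c i j = 0 := by
  obtain ⟨c, h1, h2, h3⟩ := hf
  refine ⟨fun i j ↦ c i j + (-1) ^ i * c i (n - j), fun t ht ↦ ?_, fun i hi j hj ↦ ?_, ?_,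
    fun i hi ↦ ?_⟩
  · have ht' : ∀ j ≤ n, (-n - t) + (j : ℝ) ≠ 0 := fun j hj h ↦ ht (n - j) (Nat.sub_le _ _) <| by
      rw [Nat.cast_sub hj]; linarith
    have h4 := h1 _ ht'
    rw [hsymm t ht] at h4
    rw [two_mul]
    nth_rw 1 [h1 t ht]
    rw [← neg_eq_iff_eq_neg.2 h4.symm, ← sum_neg_distrib, ← sum_add_distrib]
    refine sum_congr rfl fun i _ ↦ ?_
    rw [← sum_neg_distrib]
    nth_rw 2 [← sum_range_reflect]
    rw [← sum_add_distrib]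
    refine sum_congr rfl fun j hj ↦ ?_
    have hj' := Nat.lt_succ_iff.1 (mem_range.1 hj)
    rw [add_tsub_cancel_right, Nat.cast_sub hj',
      show (-n - t + ((n : ℝ) - j)) = -(t + j) by ring, neg_pow (t + (j : ℝ)), add_div]
    congr 1
    have := ht j hj'
    rcases Nat.even_or_odd i with h | h
    · rw [h.neg_one_pow, h.add_one.neg_one_pow]
      field_simp
    · rw [h.neg_one_pow, h.add_one.neg_one_pow]
      field_simp
  · obtain ⟨z, hz⟩ := h2 i hi j hj
    obtain ⟨z', hz'⟩ := h2 i hi (n - j) (Nat.sub_le _ _)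
    refine ⟨z + (-1) ^ i * z', ?_⟩
    rw [mul_add, mul_left_comm, hz, hz']
    simp
  · refine le_trans (sum_le_sum fun i _ ↦ sum_le_sum fun j _ ↦ abs_add_le _ _) ?_
    simp only [sum_add_distrib, abs_mul, abs_pow, abs_neg, abs_one, one_pow, one_mul]
    have h (i : ℕ) : ∑ j ∈ range (n + 1), |c i (n - j)| = ∑ j ∈ range (n + 1), |c i j| := by
      simpa using sum_range_reflect (fun j ↦ |c i j|) (n + 1)
    simp only [h]
    linarith
  · have h : ∑ j ∈ range (n + 1), c i (n - j) = ∑ j ∈ range (n + 1), c i j := by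
      simpa using sum_range_reflect (fun j ↦ c i j) (n + 1)
    simp only [sum_add_distrib, ← mul_sum, h, hi.neg_one_pow]
    ring

theorem HasPartialFractions.exists_linear_form {n d a : ℕ} {B S : ℝ} {f : ℝ → ℝ}
    (hd : ∀ x, 1 ≤ x → x ≤ n → x ∣ d) (hf : HasPartialFractions n d a B f)
    (hsymm : ∀ t, (∀ j ≤ n, t + (j : ℝ) ≠ 0) → f (-n - t) = -f t)
    (hS : HasSum (fun u : ℕ ↦ f (u + 1)) S)
    (hlim : Tendsto (fun u : ℕ ↦ ((u : ℝ) + 1) * f (u + 1)) atTop (𝓝 0)) :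
    ∃ l : Option (Fin a) → ℤ, 2 * d ^ a * S = ∑ i, l i * zetaVector a i ∧
      ∀ i, |(l i : ℝ)| ≤ 2 * (n + 1) * B * d ^ a := by
  obtain ⟨c, h1, h2, h3, h4⟩ := hf.symmetrize hsymm
  have h1' (u : ℕ) : 2 * f (u + 1) =
      ∑ i ∈ range a, ∑ j ∈ range (n + 1), c i j * (1 / ((u : ℝ) + j + 1) ^ (i + 1)) := by
    rw [h1 _ fun j _ ↦ by positivity]
    refine sum_congr rfl fun i _ ↦ sum_congr rfl fun j _ ↦ ?_
    rw [add_right_comm, mul_one_div]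
  have h5 : 0 < a → ∑ j ∈ range (n + 1), c 0 j = 0 := by
    intro ha
    have hl : Tendsto (fun u : ℕ ↦ ∑ i ∈ range a, ∑ j ∈ range (n + 1),
        c i j * (((u : ℝ) + 1) * (1 / ((u : ℝ) + j + 1) ^ (i + 1)))) atTop
        (𝓝 (∑ i ∈ range a, ∑ j ∈ range (n + 1), c i j * if i = 0 then 1 else 0)) := by
      refine tendsto_finsetSum _ fun i _ ↦ tendsto_finsetSum _ fun j _ ↦ Tendsto.const_mul _ ?_
      have h0 : Tendsto (fun u : ℕ ↦ ((u : ℝ) + 1) * (1 / ((u : ℝ) + j + 1))) atTop (𝓝 1) := by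
        have := ((tendsto_one_div_nat_add_pow 0 j).const_mul (j : ℝ)).const_sub 1
        rw [mul_zero, sub_zero] at this
        refine this.congr fun u ↦ ?_
        field_simp
        ring
      rcases i with - | i
      · simpa using h0
      · have := h0.mul (tendsto_one_div_nat_add_pow i j)
        rw [mul_zero] at this
        simp only [Nat.succ_ne_zero, if_false]
        refine this.congr fun u ↦ ?_
        rw [pow_succ _ (i + 1)]
        field_simp
    have h6 : ∑ i ∈ range a, ∑ j ∈ range (n + 1), c i j * (if i = 0 then (1 : ℝ) else 0)
        = ∑ j ∈ range (n + 1), c 0 j := by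
      rw [sum_eq_single_of_mem 0 (mem_range.2 ha)]
      · simp
      · intro b _ hb; simp [hb]
    rw [← h6]
    have h7 := hlim.const_mul 2
    rw [mul_zero] at h7
    refine tendsto_nhds_unique hl (h7.congr fun u ↦ ?_)
    rw [mul_left_comm, h1' u, mul_sum]
    refine sum_congr rfl fun i _ ↦ ?_
    rw [mul_sum]
    exact sum_congr rfl fun j _ ↦ by ring
  have hA (i : ℕ) (hi : i < a) : Tendsto (fun N ↦ (∑ j ∈ range (n + 1), c i j) *
      ∑ u ∈ range N, 1 / ((u : ℝ) + 1) ^ (i + 1)) atTop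
      (𝓝 ((∑ j ∈ range (n + 1), c i j) * zetaVector a (some ⟨i, hi⟩))) := by
    rcases Nat.even_or_odd i with he | ho
    · rcases eq_or_ne i 0 with rfl | hi0
      · simp [h5 hi]
      · refine Tendsto.const_mul _ ?_
        simp only [zetaVector, he, hi0, ne_eq, not_false_eq_true, and_self, if_true]
        have hs : Summable fun u : ℕ ↦ 1 / ((u : ℝ) + 1) ^ (i + 1) := by
          have := (summable_nat_add_iff 1).2 (Real.summable_one_div_nat_pow.2
            (show 1 < i + 1 by omega))
          simpa using this
        exact hs.hasSum.tendsto_sum_nat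
    · simp [h4 i ho]
  have hg (i : ℕ) : Tendsto (fun u : ℕ ↦ 1 / ((u : ℝ) + 1) ^ (i + 1)) atTop (𝓝 0) := by
    simpa using tendsto_one_div_nat_add_pow i 0
  have hlimS : Tendsto (fun N ↦ ∑ u ∈ range N, 2 * f (u + 1)) atTop
      (𝓝 (∑ i : Fin a, (∑ j ∈ range (n + 1), c i j *
        (-∑ u ∈ range j, 1 / ((u : ℝ) + 1) ^ ((i : ℕ) + 1)) +
        (∑ j ∈ range (n + 1), c i j) * zetaVector a (some i)))) := by
    have := tendsto_finsetSum (univ : Finset (Fin a)) fun i _ ↦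
      (tendsto_finsetSum (range (n + 1)) fun j _ ↦
        (tendsto_sum_shift_sub (hg i) j).const_mul (c i j)).add (hA i i.2)
    refine this.congr fun N ↦ ?_
    simp only [h1']
    rw [sum_comm, sum_range]
    refine sum_congr rfl fun i _ ↦ ?_
    rw [sum_comm, sum_mul, ← sum_add_distrib]
    refine sum_congr rfl fun j _ ↦ ?_
    rw [← mul_sum, ← mul_add]
    simp only [Nat.cast_add, sub_add_cancel]
  have h2S := tendsto_nhds_unique (hS.mul_left 2).tendsto_sum_nat hlimS
  have hint0 : (d : ℝ) ^ a * (∑ i : Fin a, ∑ j ∈ range (n + 1), c i j *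
      (-∑ u ∈ range j, 1 / ((u : ℝ) + 1) ^ ((i : ℕ) + 1))) ∈ (Int.castRingHom ℝ).range := by
    rw [mul_sum]
    refine sum_mem fun i _ ↦ ?_
    rw [mul_sum]
    refine sum_mem fun j hj ↦ ?_
    rw [mul_neg, mul_neg, mul_sum, mul_sum]
    refine neg_mem (sum_mem fun u hu ↦ ?_)
    rw [mem_range] at hu hj
    obtain ⟨y, hy⟩ := hd (u + 1) (by omega) (by omega)
    have : (d : ℝ) ^ a * (c i j * (1 / ((u : ℝ) + 1) ^ ((i : ℕ) + 1)))
        = ((d : ℝ) ^ (a - 1 - i) * c i j) * (y : ℝ) ^ ((i : ℕ) + 1) := by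
      have hy' : (y : ℝ) = d / (u + 1) := by rw [hy]; push_cast; field_simp
      have hexp : (d : ℝ) ^ a = d ^ (a - 1 - i) * d ^ ((i : ℕ) + 1) := by
        rw [← pow_add]; congr 1; omega
      rw [hy', hexp, div_pow]
      ring
    rw [this]
    exact mul_mem (h2 i i.2 j (by omega))
      (pow_mem (show (y : ℝ) ∈ (Int.castRingHom ℝ).range from ⟨y, by simp⟩) _)
  have hint (i : Fin a) : (d : ℝ) ^ a * ∑ j ∈ range (n + 1), c i j ∈ (Int.castRingHom ℝ).range := by
    rw [mul_sum]
    refine sum_mem fun j hj ↦ ?_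
    have hexp : (d : ℝ) ^ a = d ^ ((i : ℕ) + 1) * d ^ (a - 1 - i) := by
      rw [← pow_add]; congr 1; omega
    rw [hexp, mul_assoc]
    exact mul_mem (pow_mem (show (d : ℝ) ∈ (Int.castRingHom ℝ).range from ⟨d, by simp⟩) _)
      (h2 i i.2 j (Nat.lt_succ_iff.1 (mem_range.1 hj)))
  obtain ⟨l0, hl0⟩ := hint0
  choose l hl using hint
  simp only [eq_intCast] at hl0 hl
  have hd0 : (0 : ℝ) ≤ d ^ a := by positivity
  have h3' : ∑ i : Fin a, ∑ j ∈ range (n + 1), |c i j| ≤ 2 * B := by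
    rwa [sum_range] at h3
  have hB : 0 ≤ 2 * B := (sum_nonneg fun _ _ ↦ sum_nonneg fun _ _ ↦ abs_nonneg _).trans h3'
  refine ⟨fun o ↦ o.elim l0 l, ?_, ?_⟩
  · rw [Fintype.sum_option]
    simp only [Option.elim_none, Option.elim_some, hl0, hl]
    rw [mul_comm 2, mul_assoc, h2S, sum_add_distrib, mul_add, mul_sum (s := univ)
      (f := fun i : Fin a ↦ (∑ j ∈ range (n + 1), c i j) * zetaVector a (some i))]
    simp only [zetaVector, mul_one, mul_assoc]
  · rintro (- | i)
    · simp only [Option.elim_none, hl0]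
      rw [abs_mul, abs_of_nonneg hd0, mul_comm]
      gcongr
      calc _ ≤ ∑ i : Fin a, ∑ j ∈ range (n + 1), |c i j| * (n + 1) := by
            refine (abs_sum_le_sum_abs _ _).trans (sum_le_sum fun i _ ↦
              (abs_sum_le_sum_abs _ _).trans (sum_le_sum fun j hj ↦ ?_))
            rw [abs_mul, abs_neg]
            gcongr
            have hj' : (j : ℝ) ≤ n := by exact_mod_cast Nat.lt_succ_iff.1 (mem_range.1 hj)
            calc _ ≤ ∑ u ∈ range j, (1 : ℝ) := by
                  refine (abs_sum_le_sum_abs _ _).trans (sum_le_sum fun u _ ↦ ?_)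
                  rw [abs_of_nonneg (by positivity)]
                  exact div_le_one_of_le₀ (one_le_pow₀ (by linarith [u.cast_nonneg (α := ℝ)]))
                    (by positivity)
              _ ≤ _ := by simp; linarith
        _ ≤ _ := by
            simp only [← sum_mul]
            calc _ ≤ 2 * B * (n + 1) := by gcongr
              _ = _ := by ring
    · simp only [Option.elim_some, hl]
      rw [abs_mul, abs_of_nonneg hd0, mul_comm]
      gcongr
      calc _ ≤ ∑ j ∈ range (n + 1), |c i j| := abs_sum_le_sum_abs _ _
        _ ≤ ∑ i : Fin a, ∑ j ∈ range (n + 1), |c i j| :=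
          single_le_sum (f := fun i : Fin a ↦ ∑ j ∈ range (n + 1), |c i j|)
            (fun _ _ ↦ sum_nonneg fun _ _ ↦ abs_nonneg _) (mem_univ i)
        _ ≤ 2 * B := h3'
        _ ≤ _ := by nlinarith [n.cast_nonneg (α := ℝ)]

theorem ballRivoal_neg_sub {a r n : ℕ} (ha : Odd a) (hn : Even n) (t : ℝ) :
    ballRivoal a r n (-n - t) = -ballRivoal a r n t := by
  have h1 : ∏ i ∈ range (r * n), (-n - t - ((i : ℝ) + 1)) =
      ∏ i ∈ range (r * n), (t + n + ((i : ℝ) + 1)) := by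
    have h : (-1 : ℝ) ^ (r * n) = 1 := (hn.mul_left r).neg_one_pow
    rw [← one_mul (∏ i ∈ range (r * n), (t + n + ((i : ℝ) + 1))), ← h, ← card_range (r * n),
      ← prod_const, card_range, ← prod_mul_distrib]
    exact prod_congr rfl fun i _ ↦ by ring
  have h2 : ∏ i ∈ range (r * n), (-n - t + n + ((i : ℝ) + 1)) =
      ∏ i ∈ range (r * n), (t - ((i : ℝ) + 1)) := by
    have h : (-1 : ℝ) ^ (r * n) = 1 := (hn.mul_left r).neg_one_pow
    rw [← one_mul (∏ i ∈ range (r * n), (t - ((i : ℝ) + 1))), ← h, ← card_range (r * n),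
      ← prod_const, card_range, ← prod_mul_distrib]
    exact prod_congr rfl fun i _ ↦ by ring
  have h3 : ∏ j ∈ range (n + 1), (-n - t + (j : ℝ)) = -∏ j ∈ range (n + 1), (t + (j : ℝ)) := by
    have h : (-1 : ℝ) ^ (n + 1) = -1 := hn.add_one.neg_one_pow
    rw [neg_eq_neg_one_mul (∏ j ∈ range (n + 1), (t + (j : ℝ))), ← h, ← card_range (n + 1),
      ← prod_const, card_range, ← prod_mul_distrib, ← prod_range_reflect]
    refine prod_congr rfl fun j hj ↦ ?_
    rw [add_tsub_cancel_right, Nat.cast_sub (Nat.lt_succ_iff.1 (mem_range.1 hj))]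
    ring
  rw [ballRivoal, ballRivoal, h1, h2, h3, ha.neg_pow, div_neg]
  congr 2
  ring

theorem prod_add_eq_factorial_div (k n : ℕ) :
    ∏ i ∈ range n, ((k : ℝ) + (i + 1)) = (k + n).factorial / k.factorial := by
  have h : (k.factorial : ℝ) ≠ 0 := Nat.cast_ne_zero.2 (Nat.factorial_ne_zero _)
  rw [eq_div_iff h, mul_comm, ← Nat.factorial_mul_ascFactorial, Nat.ascFactorial_eq_prod_range,
    Nat.cast_mul, Nat.cast_prod]
  congr 1
  refine prod_congr rfl fun i _ ↦ ?_
  push_cast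
  ring

theorem ballRivoal_eq_zero {a r n u : ℕ} (h : u < r * n) : ballRivoal a r n (u + 1) = 0 := by
  rw [ballRivoal, prod_eq_zero (mem_range.2 h) (by ring)]
  simp

theorem ballRivoal_eq {a r : ℕ} (har : 2 * r ≤ a) (n u : ℕ) :
    ballRivoal a r n ((u + r * n : ℕ) + 1) =
      (n.factorial * (u + r * n).factorial / (u + r * n + n + 1).factorial : ℝ) ^ (a + 1) *
      ((u + r * n + n + 1 + r * n).factorial / (u.factorial * n.factorial ^ (2 * r + 1))) := by
  obtain ⟨q, rfl⟩ : ∃ q, a = 2 * r + q := ⟨a - 2 * r, by omega⟩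
  have h1 : ∏ i ∈ range (r * n), (((u + r * n : ℕ) : ℝ) + 1 - ((i : ℝ) + 1)) =
      (u + r * n).factorial / u.factorial := by
    rw [← prod_add_eq_factorial_div, ← prod_range_reflect]
    refine prod_congr rfl fun i hi ↦ ?_
    rw [mem_range] at hi
    rw [Nat.cast_sub (by omega), Nat.cast_sub (by omega)]
    push_cast
    ring
  have h2 : ∏ i ∈ range (r * n), (((u + r * n : ℕ) : ℝ) + 1 + n + ((i : ℝ) + 1)) =
      (u + r * n + n + 1 + r * n).factorial / (u + r * n + n + 1).factorial := by
    rw [← prod_add_eq_factorial_div]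
    refine prod_congr rfl fun i hi ↦ ?_
    push_cast
    ring
  have h3 : ∏ i ∈ range (n + 1), (((u + r * n : ℕ) : ℝ) + 1 + (i : ℝ)) =
      (u + r * n + n + 1).factorial / (u + r * n).factorial := by
    rw [add_assoc _ n 1, ← prod_add_eq_factorial_div]
    refine prod_congr rfl fun i hi ↦ ?_
    push_cast
    ring
  rw [ballRivoal, h1, h2, h3, Nat.add_sub_cancel_left]
  have hp (k : ℕ) : (k.factorial : ℝ) ≠ 0 := Nat.cast_ne_zero.2 (Nat.factorial_ne_zero _)
  have hX := hp (u + r * n)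
  have hZ := hp (u + r * n + n + 1)
  have hn := hp n
  have hu := hp u
  generalize ((u + r * n).factorial : ℝ) = X at *
  generalize ((u + r * n + n + 1).factorial : ℝ) = Z at *
  generalize ((u + r * n + n + 1 + r * n).factorial : ℝ) = Y at *
  generalize (n.factorial : ℝ) = N at *
  generalize (u.factorial : ℝ) = W at *
  simp only [div_pow, mul_pow, pow_add, pow_one]
  field_simp

theorem ballRivoal_pos {a r : ℕ} (har : 2 * r ≤ a) (n u : ℕ) :
    0 < ballRivoal a r n ((u + r * n : ℕ) + 1) := by
  rw [ballRivoal_eq har]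
  have hp (k : ℕ) : 0 < (k.factorial : ℝ) := Nat.cast_pos.2 (Nat.factorial_pos _)
  have := hp n
  have := hp u
  have := hp (u + r * n)
  have := hp (u + r * n + n + 1)
  have := hp (u + r * n + n + 1 + r * n)
  positivity

theorem ballRivoal_le_mul_succ {a r C : ℕ} (har : 2 * r ≤ a) (hr : 1 ≤ r) {n u : ℕ}
    (hu : u ≤ C * (n + 1)) :
    ballRivoal a r n ((u + r * n : ℕ) + 1) ≤ (((C + r + 2 : ℕ) : ℝ) ^ (r + 1)) ^ (a + 1) *
      ballRivoal a r (n + 1) ((u + r * (n + 1) : ℕ) + 1) := by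
  rw [ballRivoal_eq har, ballRivoal_eq har, ← mul_assoc, ← mul_pow]
  have hp (k : ℕ) : 0 < (k.factorial : ℝ) := Nat.cast_pos.2 (Nat.factorial_pos _)
  have hn := hp n
  have hn' := hp (n + 1)
  have hu' := hp u
  have hX := hp (u + r * n)
  have hZ := hp (u + r * n + n + 1)
  have hZ' := hp (u + r * (n + 1) + (n + 1) + 1)
  have hY' := hp (u + r * n + n + 1 + r * n)
  have hX' := hp (u + r * (n + 1))
  have hrn : n ≤ r * n := Nat.le_mul_of_pos_left n hr
  refine mul_le_mul (pow_le_pow_left₀ (by positivity) ?_ _) ?_ (by positivity) (by positivity)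
  · rw [mul_div_assoc', div_le_div_iff₀ hZ hZ']
    have h1 : (u + r * (n + 1) + (n + 1) + 1).factorial ≤
        (u + r * n + n + 1).factorial * ((C + r + 2) * (n + 1)) ^ (r + 1) := by
      rw [show u + r * (n + 1) + (n + 1) + 1 = u + r * n + n + 1 + (r + 1) by ring,
        ← Nat.factorial_mul_ascFactorial]
      refine Nat.mul_le_mul_left _ ((Nat.ascFactorial_le_pow_add _ _).trans
        (Nat.pow_le_pow_left ?_ _))
      nlinarith
    have h2 : (u + r * n).factorial * (n + 1) ^ r ≤ (u + r * (n + 1)).factorial := by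
      rw [show u + r * (n + 1) = u + r * n + r by ring]
      exact (Nat.mul_le_mul_left _ (Nat.pow_le_pow_left (by omega) _)).trans
        Nat.factorial_mul_pow_le_factorial
    have h3 : n.factorial * (u + r * n).factorial * (u + r * (n + 1) + (n + 1) + 1).factorial ≤
        (C + r + 2) ^ (r + 1) * ((n + 1).factorial * (u + r * (n + 1)).factorial) *
          (u + r * n + n + 1).factorial := by
      calc _ ≤ n.factorial * (u + r * n).factorial *
            ((u + r * n + n + 1).factorial * ((C + r + 2) * (n + 1)) ^ (r + 1)) := by gcongr
        _ = (C + r + 2) ^ (r + 1) * ((n + 1) * n.factorial *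
            ((u + r * n).factorial * (n + 1) ^ r)) * (u + r * n + n + 1).factorial := by
          rw [mul_pow]; ring
        _ ≤ _ := by
          rw [← Nat.factorial_succ]
          exact Nat.mul_le_mul_right _ (Nat.mul_le_mul_left _ (Nat.mul_le_mul_left _ h2))
    exact_mod_cast h3
  · rw [div_le_div_iff₀ (by positivity) (by positivity)]
    have h1 : (u + r * n + n + 1 + r * n).factorial * (n + 1) ^ (2 * r + 1) ≤
        (u + r * (n + 1) + (n + 1) + 1 + r * (n + 1)).factorial := by
      rw [show u + r * (n + 1) + (n + 1) + 1 + r * (n + 1)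
        = u + r * n + n + 1 + r * n + (2 * r + 1) by ring]
      exact (Nat.mul_le_mul_left _ (Nat.pow_le_pow_left (by omega) _)).trans
        Nat.factorial_mul_pow_le_factorial
    have h2 : (u + r * n + n + 1 + r * n).factorial *
        (u.factorial * (n + 1).factorial ^ (2 * r + 1)) ≤
        (u + r * (n + 1) + (n + 1) + 1 + r * (n + 1)).factorial *
        (u.factorial * n.factorial ^ (2 * r + 1)) := by
      rw [Nat.factorial_succ n, mul_pow, mul_left_comm, ← mul_assoc _ ((n + 1) ^ _), mul_left_comm]
      gcongr
    exact_mod_cast h2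

theorem add_one_mul_ballRivoal_succ_le {a r n u : ℕ} (har : 4 * r + 4 ≤ a) (hr : 1 ≤ r)
    (hu : 4 * (r + 1) * (n + 1) ≤ u) :
    ((u : ℝ) + 1) * ballRivoal a r n ((u + 1 + r * n : ℕ) + 1) ≤
      ((u : ℝ) - 1) * ballRivoal a r n ((u + r * n : ℕ) + 1) := by
  rw [ballRivoal_eq (by omega), ballRivoal_eq (by omega)]
  have hp (k : ℕ) : 0 < (k.factorial : ℝ) := Nat.cast_pos.2 (Nat.factorial_pos _)
  have hn := hp n
  have hu' := hp u
  have hX := hp (u + r * n)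
  have hZ := hp (u + r * n + n + 1)
  have hY := hp (u + r * n + n + 1 + r * n)
  rw [show u + 1 + r * n + n + 1 + r * n = u + r * n + n + 1 + r * n + 1 by ring,
    show u + 1 + r * n + n + 1 = u + r * n + n + 1 + 1 by ring,
    show u + 1 + r * n = u + r * n + 1 by ring]
  rw [Nat.factorial_succ (u + r * n + n + 1 + r * n), Nat.factorial_succ (u + r * n + n + 1),
    Nat.factorial_succ (u + r * n), Nat.factorial_succ u]
  have hrn : (r : ℝ) * n = (r * n : ℕ) := by push_cast; rfl
  have hur : 4 * ((r : ℝ) + 1) * (n + 1) ≤ u := by exact_mod_cast hu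
  have har' : 4 * (r : ℝ) + 4 ≤ a := by exact_mod_cast har
  have hr' : 1 ≤ (r : ℝ) := by exact_mod_cast hr
  have hn0 : (0 : ℝ) ≤ n := n.cast_nonneg
  have hr0 : (0 : ℝ) ≤ r := r.cast_nonneg
  have hrn0 : (0 : ℝ) ≤ r * n := by positivity
  have hu1 : 0 < (u : ℝ) - 1 := by nlinarith
  have hx : 0 < (u : ℝ) + r * n + 1 := by linarith
  have hbern : 1 + (a + 1 : ℝ) * ((n + 1) / (u + r * n + 1)) ≤
      ((u + r * n + n + 2) / (u + r * n + 1)) ^ (a + 1) := by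
    have h := one_add_mul_le_pow (a := ((n : ℝ) + 1) / (u + r * n + 1))
      (by have : 0 ≤ ((n : ℝ) + 1) / (u + r * n + 1) := by positivity
          linarith) (a + 1)
    push_cast at h
    refine h.trans (le_of_eq ?_)
    congr 1
    field_simp
    ring
  have hkey : (u + 2 * (r * n) + n + 2 : ℝ) * (u + r * n + 1) ^ (a + 1) ≤
      (u - 1) * (u + r * n + n + 2) ^ (a + 1) := by
    have h1 : (u + 2 * (r * n) + n + 2 : ℝ) ≤
        (u - 1) * (1 + (a + 1 : ℝ) * ((n + 1) / (u + r * n + 1))) := by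
      have h2 : (2 * (r * n) + n + 3 : ℝ) * (u + r * n + 1) ≤ (u - 1) * ((a + 1) * (n + 1)) := by
        have h3 : (u + r * n + 1 : ℝ) ≤ 3 / 2 * (u - 1) := by linarith
        have h4 : (2 * (r * n) + n + 3 : ℝ) * (3 / 2) ≤ (a + 1) * (n + 1) := by nlinarith
        calc _ ≤ (2 * (r * n) + n + 3 : ℝ) * (3 / 2 * (u - 1)) := by gcongr
          _ = (u - 1) * ((2 * (r * n) + n + 3 : ℝ) * (3 / 2)) := by ring
          _ ≤ _ := by gcongr
      have h5 : (2 * (r * n) + n + 3 : ℝ) ≤ (u - 1) * ((a + 1) * (n + 1)) / (u + r * n + 1) := by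
        rwa [le_div_iff₀ hx]
      calc _ = (u - 1 : ℝ) + (2 * (r * n) + n + 3) := by ring
        _ ≤ _ := by
          refine (add_le_add_right h5 _).trans (le_of_eq ?_)
          ring
    calc _ ≤ (u - 1) * ((u + r * n + n + 2) / (u + r * n + 1) : ℝ) ^ (a + 1)
          * (u + r * n + 1) ^ (a + 1) := by
          gcongr
          exact h1.trans (by gcongr)
      _ = _ := by rw [div_pow]; field_simp
  push_cast
  generalize ((u + r * n).factorial : ℝ) = X at *
  generalize ((u + r * n + n + 1).factorial : ℝ) = Z at *
  generalize ((u + r * n + n + 1 + r * n).factorial : ℝ) = Y at *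
  generalize (n.factorial : ℝ) = N at *
  generalize (u.factorial : ℝ) = W at *
  have hz : (0 : ℝ) < u + r * n + n + 1 + 1 := by positivity
  calc _ = (N * X / Z) ^ (a + 1) * (Y / (W * N ^ (2 * r + 1))) *
        ((u + 2 * (r * n) + n + 2) * (u + r * n + 1) ^ (a + 1) /
          (u + r * n + n + 2) ^ (a + 1)) := by
        rw [show (u : ℝ) + r * n + n + 2 = u + r * n + n + 1 + 1 by ring,
          show (u : ℝ) + 2 * (r * n) + n + 2 = u + r * n + n + 1 + r * n + 1 by ring]
        simp only [div_pow, mul_pow]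
        field_simp
    _ ≤ (N * X / Z) ^ (a + 1) * (Y / (W * N ^ (2 * r + 1))) * (u - 1) := by
        gcongr
        rw [div_le_iff₀ (by positivity)]
        exact hkey
    _ = _ := by ring

theorem ballRivoal_le {a r : ℕ} (har : 2 * r < a) (hr : 1 ≤ r) (n u : ℕ) :
    ballRivoal a r n ((u + r * n : ℕ) + 1) ≤
      (n.factorial / ((r : ℝ) * n) ^ n) ^ (a - 2 * r) * (1 / (((u + r * n : ℕ) : ℝ) + 1) ^ 2) := by
  obtain ⟨q, rfl⟩ : ∃ q, a = 2 * r + (q + 1) := ⟨a - 2 * r - 1, by omega⟩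
  rw [ballRivoal, Nat.add_sub_cancel_left]
  have hlow : (r : ℝ) * n ≤ ((u + r * n : ℕ) : ℝ) + 1 := by
    push_cast; linarith [u.cast_nonneg (α := ℝ)]
  have hle (i : ℕ) (hi : i < r * n) : (i : ℝ) + 1 ≤ ((u + r * n : ℕ) : ℝ) + 1 := by
    gcongr; omega
  have ht1 : 1 ≤ ((u + r * n : ℕ) : ℝ) + 1 := by linarith [(u + r * n).cast_nonneg (α := ℝ)]
  generalize ((u + r * n : ℕ) : ℝ) + 1 = t at *
  have ht0 : 0 < t := by linarith
  have hn0 : (0 : ℝ) ≤ n := n.cast_nonneg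
  have hrn : 0 < ((r : ℝ) * n) ^ n := by
    rcases Nat.eq_zero_or_pos n with rfl | hn
    · simp
    · positivity
  have hnum : (∏ i ∈ range (r * n), (t - (i + 1))) * (∏ i ∈ range (r * n), (t + n + (i + 1))) ≤
      (t * (t + n)) ^ (r * n) := by
    rw [← prod_mul_distrib]
    conv_rhs => rw [← card_range (r * n), ← prod_const]
    refine prod_le_prod (fun i hi ↦ mul_nonneg ?_ (by positivity)) fun i _ ↦ ?_
    · linarith [hle i (mem_range.1 hi)]
    · nlinarith [i.cast_nonneg (α := ℝ)]
  have hD1 : t ^ (n + 1) ≤ ∏ j ∈ range (n + 1), (t + (j : ℝ)) := by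
    conv_lhs => rw [← card_range (n + 1), ← prod_const]
    exact prod_le_prod (fun _ _ ↦ ht0.le) fun j _ ↦ by linarith [j.cast_nonneg (α := ℝ)]
  have hD2 : (t * (t + n)) ^ (n + 1) ≤ (∏ j ∈ range (n + 1), (t + (j : ℝ))) ^ 2 := by
    rw [sq]
    nth_rw 2 [← prod_range_reflect]
    rw [← prod_mul_distrib]
    conv_lhs => rw [← card_range (n + 1), ← prod_const]
    refine prod_le_prod (fun _ _ ↦ by positivity) fun j hj ↦ ?_
    have hj' := Nat.lt_succ_iff.1 (mem_range.1 hj)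
    rw [add_tsub_cancel_right, Nat.cast_sub hj']
    have : (j : ℝ) ≤ n := by exact_mod_cast hj'
    nlinarith [mul_nonneg (j.cast_nonneg (α := ℝ)) (sub_nonneg.2 this)]
  have hD : ((t * (t + n)) ^ (n + 1)) ^ r * (t ^ (n + 1)) ^ (q + 1) ≤
      (∏ j ∈ range (n + 1), (t + (j : ℝ))) ^ (2 * r + (q + 1)) := by
    rw [pow_add _ (2 * r), pow_mul _ 2 r]
    gcongr
  rw [mul_assoc]
  calc _ ≤ (n.factorial : ℝ) ^ (q + 1) * (t * (t + n)) ^ (r * n) /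
        (((t * (t + n)) ^ (n + 1)) ^ r * (t ^ (n + 1)) ^ (q + 1)) := by gcongr
    _ = (n.factorial / t ^ n) ^ (q + 1) * (1 / (t ^ (q + 1) * (t * (t + n)) ^ r)) := by
      have hP : t * (t + n) ≠ 0 := by positivity
      generalize t * (t + n) = P at hP ⊢
      rw [div_pow]
      field_simp
      ring
    _ ≤ _ := by
      have h1 : t ^ 2 ≤ t ^ (q + 1) * (t * (t + n)) ^ r := by
        rw [sq]
        refine mul_le_mul (le_self_pow₀ ht1 (Nat.succ_ne_zero q)) ?_ ht0.le (by positivity)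
        have h2 : t ≤ t * (t + n) := le_mul_of_one_le_right ht0.le (by linarith)
        exact h2.trans (le_self_pow₀ (ht1.trans h2) (by omega))
      gcongr

/-- The value at `1` of the hypergeometric series of Ball and Rivoal. -/
noncomputable def ballRivoalSum (a r n : ℕ) : ℝ :=
  ∑' u : ℕ, ballRivoal a r n ((u + r * n : ℕ) + 1)

theorem summable_one_div_nat_add_one_sq : Summable fun u : ℕ ↦ 1 / ((u : ℝ) + 1) ^ 2 := by
  simpa using (summable_nat_add_iff 1).2 (Real.summable_one_div_nat_pow.2 one_lt_two)

theorem one_div_add_mul_sq_le (r n u : ℕ) :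
    1 / (((u + r * n : ℕ) : ℝ) + 1) ^ 2 ≤ 1 / ((u : ℝ) + 1) ^ 2 := by
  gcongr
  omega

theorem summable_ballRivoal {a r : ℕ} (har : 2 * r < a) (hr : 1 ≤ r) (n : ℕ) :
    Summable fun u : ℕ ↦ ballRivoal a r n ((u + r * n : ℕ) + 1) :=
  (summable_one_div_nat_add_one_sq.mul_left
    ((n.factorial / ((r : ℝ) * n) ^ n) ^ (a - 2 * r))).of_nonneg_of_le
    (fun u ↦ (ballRivoal_pos har.le n u).le) fun u ↦ (ballRivoal_le har hr n u).trans <|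
      mul_le_mul_of_nonneg_left (one_div_add_mul_sq_le r n u) (by positivity)

theorem hasSum_ballRivoal {a r : ℕ} (har : 2 * r < a) (hr : 1 ≤ r) (n : ℕ) :
    HasSum (fun u : ℕ ↦ ballRivoal a r n (u + 1)) (ballRivoalSum a r n) := by
  have h := (hasSum_nat_add_iff (f := fun u : ℕ ↦ ballRivoal a r n (u + 1)) (r * n)).1
    (summable_ballRivoal har hr n).hasSum
  rwa [sum_eq_zero fun u hu ↦ ballRivoal_eq_zero (mem_range.1 hu), add_zero] at h

theorem tendsto_mul_ballRivoal {a r : ℕ} (har : 2 * r < a) (hr : 1 ≤ r) (n : ℕ) :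
    Tendsto (fun u : ℕ ↦ ((u : ℝ) + 1) * ballRivoal a r n (u + 1)) atTop (𝓝 0) := by
  rw [← tendsto_add_atTop_iff_nat (r * n)]
  have h := (tendsto_one_div_add_atTop_nhds_zero_nat (𝕜 := ℝ)).const_mul
    ((n.factorial / ((r : ℝ) * n) ^ n) ^ (a - 2 * r))
  rw [mul_zero] at h
  refine squeeze_zero (fun u ↦ ?_) (fun u ↦ ?_) (h.comp (tendsto_add_atTop_nat (r * n)))
  · exact mul_nonneg (by positivity) (ballRivoal_pos har.le n u).le
  · refine (mul_le_mul_of_nonneg_left (ballRivoal_le har hr n u) (by positivity)).trans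
      (le_of_eq ?_)
    simp only [Function.comp_apply]
    have : ((u + r * n : ℕ) : ℝ) + 1 ≠ 0 := by positivity
    field_simp

theorem ballRivoalSum_pos {a r : ℕ} (har : 2 * r < a) (hr : 1 ≤ r) (n : ℕ) :
    0 < ballRivoalSum a r n :=
  (summable_ballRivoal har hr n).tsum_pos (fun u ↦ (ballRivoal_pos har.le n u).le) 0
    (ballRivoal_pos har.le n 0)

theorem ballRivoalSum_le {a r : ℕ} (har : 2 * r < a) (hr : 1 ≤ r) (n : ℕ) :
    ballRivoalSum a r n ≤ (n.factorial / ((r : ℝ) * n) ^ n) ^ (a - 2 * r) *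
      ∑' u : ℕ, 1 / ((u : ℝ) + 1) ^ 2 := by
  rw [← tsum_mul_left]
  exact (summable_ballRivoal har hr n).tsum_le_tsum (fun u ↦ (ballRivoal_le har hr n u).trans <|
      mul_le_mul_of_nonneg_left (one_div_add_mul_sq_le r n u) (by positivity))
    (summable_one_div_nat_add_one_sq.mul_left _)

theorem tsum_le_sum_add_mul {v : ℕ → ℝ} {U : ℕ} (hU : 1 ≤ U) (hv : ∀ u, 0 ≤ v u)
    (hs : Summable v) (h : ∀ u, U ≤ u → ((u : ℝ) + 1) * v (u + 1) ≤ ((u : ℝ) - 1) * v u) :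
    ∑' u, v u ≤ ∑ u ∈ range U, v u + U * v U := by
  have hU' : (1 : ℝ) ≤ U := by exact_mod_cast hU
  have key (N : ℕ) : ∑ u ∈ range (N + 1), v (u + U) + ((U : ℝ) + N - 1) * v (N + U) ≤ U * v U := by
    induction N with
    | zero => simp; linarith
    | succ N ih =>
      rw [sum_range_succ]
      have h1 := h (N + U) (by omega)
      rw [show N + 1 + U = N + U + 1 by ring]
      push_cast at h1 ⊢
      nlinarith
  rw [← hs.sum_add_tsum_nat_add U]
  gcongr
  refine Real.tsum_le_of_sum_range_le (fun u ↦ hv _) fun N ↦ ?_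
  have h1 := key N
  rw [sum_range_succ] at h1
  have h2 : 0 ≤ ((U : ℝ) + N - 1) * v (N + U) :=
    mul_nonneg (by linarith [N.cast_nonneg (α := ℝ)]) (hv _)
  linarith [hv (N + U)]

theorem exists_ballRivoalSum_le_mul_succ {a r : ℕ} (har : 4 * r + 4 ≤ a) (hr : 1 ≤ r) :
    ∃ K : ℝ, 1 ≤ K ∧ ∀ n : ℕ,
      ballRivoalSum a r n ≤ K * (n + 1) * ballRivoalSum a r (n + 1) := by
  have har' : 2 * r < a := by omega
  obtain ⟨C, hC⟩ : ∃ C, C = 4 * (r + 1) := ⟨_, rfl⟩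
  obtain ⟨Λ, hΛ⟩ : ∃ Λ : ℝ, Λ = (((C + r + 2 : ℕ) : ℝ) ^ (r + 1)) ^ (a + 1) := ⟨_, rfl⟩
  have hΛ1 : 1 ≤ Λ := by
    rw [hΛ]
    exact one_le_pow₀ (one_le_pow₀ (by exact_mod_cast (by omega : 1 ≤ C + r + 2)))
  have hC0 : (0 : ℝ) ≤ C := C.cast_nonneg
  refine ⟨Λ * (C + 1), one_le_mul_of_one_le_of_one_le hΛ1 (by linarith), fun n ↦ ?_⟩
  have hstep (u : ℕ) (hu : u ≤ C * (n + 1)) : ballRivoal a r n ((u + r * n : ℕ) + 1) ≤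
      Λ * ballRivoal a r (n + 1) ((u + r * (n + 1) : ℕ) + 1) :=
    hΛ ▸ ballRivoal_le_mul_succ har'.le hr hu
  have hs := summable_ballRivoal har' hr (n + 1)
  have hpos := ballRivoalSum_pos har' hr (n + 1)
  have h1 : ∑ u ∈ range (C * (n + 1)), ballRivoal a r n ((u + r * n : ℕ) + 1) ≤
      Λ * ballRivoalSum a r (n + 1) := by
    refine (sum_le_sum fun u hu ↦ hstep u (mem_range.1 hu).le).trans ?_
    rw [← mul_sum]
    gcongr
    exact hs.sum_le_tsum _ fun u _ ↦ (ballRivoal_pos har'.le _ u).le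
  have h2 : ballRivoal a r n ((C * (n + 1) + r * n : ℕ) + 1) ≤ Λ * ballRivoalSum a r (n + 1) := by
    refine (hstep _ le_rfl).trans ?_
    gcongr
    exact hs.le_tsum (C * (n + 1)) fun u _ ↦ (ballRivoal_pos har'.le _ u).le
  have h3 := tsum_le_sum_add_mul (U := C * (n + 1)) (by rw [hC]; nlinarith)
    (fun u ↦ (ballRivoal_pos har'.le n u).le) (summable_ballRivoal har' hr n)
    fun u hu ↦ add_one_mul_ballRivoal_succ_le har hr (hC ▸ hu)
  calc ballRivoalSum a r n ≤ Λ * ballRivoalSum a r (n + 1) +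
        (C * (n + 1) : ℕ) * (Λ * ballRivoalSum a r (n + 1)) := by
        refine h3.trans (add_le_add h1 ?_)
        gcongr
    _ = Λ * (C * (n + 1) + 1) * ballRivoalSum a r (n + 1) := by push_cast; ring
    _ ≤ Λ * (C + 1) * (n + 1) * ballRivoalSum a r (n + 1) := by
        rw [mul_assoc Λ (C + 1 : ℝ)]
        exact mul_le_mul_of_nonneg_right (mul_le_mul_of_nonneg_left
          (by nlinarith [n.cast_nonneg (α := ℝ)]) (by linarith)) hpos.le

theorem factorial_le_mul_pow_div_exp (n : ℕ) :
    (n.factorial : ℝ) ≤ Real.exp 1 * (n + 1) * (n / Real.exp 1) ^ n := by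
  rcases Nat.eq_zero_or_pos n with rfl | hn
  · simp
  refine le_trans (b := Real.exp 1 * n * (n / Real.exp 1) ^ n) ?_ (by gcongr; linarith)
  induction n, hn using Nat.le_induction with
  | base => simp
  | succ n hn ih =>
    have hn' : (0 : ℝ) < n := by exact_mod_cast hn
    have h1 : Real.exp 1 * (n : ℝ) ^ (n + 1) ≤ (n + 1 : ℝ) ^ (n + 1) := by
      have h2 : (n : ℝ) / (n + 1) ≤ Real.exp (-1 / (n + 1)) := by
        refine le_trans (le_of_eq ?_) (Real.add_one_le_exp _)
        field_simp
        ring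
      have h3 := pow_le_pow_left₀ (by positivity) h2 (n + 1)
      rw [← Real.exp_nat_mul, div_pow, div_le_iff₀ (by positivity)] at h3
      have h4 : ((n + 1 : ℕ) : ℝ) * (-1 / (n + 1)) = -1 := by push_cast; field_simp
      rw [h4, Real.exp_neg] at h3
      calc _ ≤ Real.exp 1 * ((Real.exp 1)⁻¹ * (n + 1 : ℝ) ^ (n + 1)) := by gcongr
        _ = _ := by field_simp
    have he := Real.exp_pos 1
    rw [Nat.factorial_succ]
    push_cast
    calc _ ≤ ((n : ℝ) + 1) * (Real.exp 1 * n * (n / Real.exp 1) ^ n) := by gcongr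
      _ = ((n : ℝ) + 1) * (Real.exp 1 * (n : ℝ) ^ (n + 1)) / Real.exp 1 ^ n := by
        rw [div_pow]; field_simp; ring
      _ ≤ ((n : ℝ) + 1) * (n + 1 : ℝ) ^ (n + 1) / Real.exp 1 ^ n := by gcongr
      _ = _ := by rw [div_pow, pow_succ (Real.exp 1)]; field_simp

theorem factorial_div_mul_pow_le {r : ℕ} (hr : 1 ≤ r) (n : ℕ) :
    (n.factorial / ((r : ℝ) * n) ^ n) ≤ Real.exp 1 * (n + 1) * ((Real.exp 1 * r) ^ n)⁻¹ := by
  rcases Nat.eq_zero_or_pos n with rfl | hn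
  · simp
  have hr' : (0 : ℝ) < r := by exact_mod_cast hr
  have hn' : (0 : ℝ) < n := by exact_mod_cast hn
  rw [div_le_iff₀ (by positivity)]
  refine (factorial_le_mul_pow_div_exp n).trans (le_of_eq ?_)
  have := Real.exp_pos 1
  rw [div_pow, mul_pow, mul_pow]
  field_simp

theorem tendsto_add_one_pow_mul_pow (k : ℕ) {ρ : ℝ} (h0 : 0 < ρ) (h1 : ρ < 1) :
    Tendsto (fun m : ℕ ↦ ((m : ℝ) + 1) ^ k * ρ ^ m) atTop (𝓝 0) := by
  have h := ((tendsto_pow_const_mul_const_pow_of_abs_lt_one k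
    (by rwa [abs_of_pos h0] : |ρ| < 1)).comp (tendsto_add_atTop_nat 1)).const_mul ρ⁻¹
  rw [mul_zero] at h
  refine h.congr fun m ↦ ?_
  simp only [Function.comp_apply]
  push_cast
  field_simp
  ring

/-- The dimension bound extracted from the linear forms of Ball and Rivoal with parameters
`a` and `r`. -/
theorem lt_finrank_of_zetaVector_mem {a r s : ℕ} (ha : Odd a) (hr : 1 ≤ r) (har : 4 * r + 4 ≤ a)
    {V : Submodule ℚ ℝ} [FiniteDimensional ℚ V] (hV : ∀ i, zetaVector a i ∈ V)
    (hlt : ((303 / 100 : ℝ) ^ a * (2 ^ a * (r + 1) ^ (2 * r + 2))) ^ s *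
      ((303 / 100) ^ a * ((Real.exp 1 * r) ^ (a - 2 * r))⁻¹) < 1) :
    s + 1 < Module.finrank ℚ V := by
  have har' : 2 * r < a := by omega
  obtain ⟨C, hC1, hC⟩ := exists_lcmUpto_le_pow
  obtain ⟨K, hK1, hK⟩ := exists_ballRivoalSum_le_mul_succ har hr
  have hr0 : (0 : ℝ) < r := by exact_mod_cast hr
  have he : 0 < Real.exp 1 := Real.exp_pos 1
  have hd1 (n : ℕ) : (1 : ℝ) ≤ (Nat.lcmUpto n : ℝ) ^ a :=
    one_le_pow₀ (by exact_mod_cast Nat.lcmUpto_pos n)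
  have hform (m : ℕ) := (hasPartialFractions_ballRivoal (a := a) (r := r) (n := 2 * m)
    (d := Nat.lcmUpto (2 * m)) (fun x h1 h2 ↦ dvd_lcm (f := id) (mem_Icc.2 ⟨h1, h2⟩))
    har').exists_linear_form (fun x h1 h2 ↦ dvd_lcm (f := id) (mem_Icc.2 ⟨h1, h2⟩))
    (fun t _ ↦ ballRivoal_neg_sub ha (even_two_mul m) t) (hasSum_ballRivoal har' hr _)
    (tendsto_mul_ballRivoal har' hr _)
  choose l hl hlb using hform
  obtain ⟨β, hβ⟩ : ∃ β : ℝ, β = (303 / 100 : ℝ) ^ a * (2 ^ a * (r + 1) ^ (2 * r + 2)) := ⟨_, rfl⟩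
  obtain ⟨α, hα⟩ : ∃ α : ℝ, α = (303 / 100) ^ a * ((Real.exp 1 * r) ^ (a - 2 * r))⁻¹ := ⟨_, rfl⟩
  obtain ⟨Z, hZ⟩ : ∃ Z : ℝ, Z = ∑' u : ℕ, 1 / ((u : ℝ) + 1) ^ 2 := ⟨_, rfl⟩
  have hZ0 : 0 ≤ Z := hZ ▸ tsum_nonneg fun u ↦ by positivity
  rw [← hβ, ← hα] at hlt
  have hβ1 : 1 ≤ β := by
    rw [hβ]
    refine one_le_mul_of_one_le_of_one_le (one_le_pow₀ (by norm_num))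
      (one_le_mul_of_one_le_of_one_le (one_le_pow₀ (by norm_num)) (one_le_pow₀ (by linarith)))
  have hα0 : 0 < α := by rw [hα]; positivity
  have hfact : (1 : ℝ) ≤ a.factorial := by exact_mod_cast Nat.factorial_pos a
  refine lt_finrank_of_small_forms hV
    (fun m ↦ 2 * (Nat.lcmUpto (2 * m) : ℝ) ^ a * ballRivoalSum a r (2 * m)) l
    (fun m ↦ 2 * (2 * m + 1) * (a.factorial * C ^ a) * β ^ (2 * m))
    (fun m ↦ (K * (2 * m + 2)) ^ 2) (fun m ↦ ?_) hl (fun m i ↦ ?_) (fun m ↦ ?_) (fun m ↦ ?_)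
    (fun m ↦ ?_) ?_
  · have := ballRivoalSum_pos har' hr (2 * m)
    have := hd1 (2 * m)
    positivity
  · refine (hlb m i).trans ?_
    calc _ ≤ 2 * (((2 * m : ℕ) : ℝ) + 1) *
          (a.factorial * (2 ^ a * (r + 1) ^ (2 * r + 2)) ^ (2 * m)) *
          (C * (303 / 100 : ℝ) ^ (2 * m)) ^ a := by
          gcongr
          exact hC _
      _ = _ := by
          rw [hβ]
          generalize (2 ^ a * ((r : ℝ) + 1) ^ (2 * r + 2)) = P
          push_cast
          simp only [mul_pow, ← pow_mul]
          ring
  · have h1 : (1 : ℝ) ≤ 2 * (2 * m + 1) := by linarith [m.cast_nonneg (α := ℝ)]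
    exact one_le_mul_of_one_le_of_one_le (one_le_mul_of_one_le_of_one_le h1
      (one_le_mul_of_one_le_of_one_le hfact (one_le_pow₀ hC1))) (one_le_pow₀ hβ1)
  · exact one_le_pow₀ (one_le_mul_of_one_le_of_one_le hK1 (by linarith [m.cast_nonneg (α := ℝ)]))
  · have h1 := hK (2 * m)
    have h2 := hK (2 * m + 1)
    have hpos := ballRivoalSum_pos har' hr (2 * m + 2)
    have hm : (0 : ℝ) ≤ m := m.cast_nonneg
    have hd : (Nat.lcmUpto (2 * m) : ℝ) ≤ Nat.lcmUpto (2 * (m + 1)) := by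
      exact_mod_cast lcmUpto_mono (by omega)
    have h3 : ballRivoalSum a r (2 * m) ≤
        (K * (2 * m + 2)) ^ 2 * ballRivoalSum a r (2 * m + 2) := by
      push_cast at h1 h2
      calc _ ≤ K * (2 * m + 1) * (K * (2 * m + 1 + 1) * ballRivoalSum a r (2 * m + 2)) :=
            h1.trans (by gcongr)
        _ ≤ K * (2 * m + 2) * (K * (2 * m + 1 + 1) * ballRivoalSum a r (2 * m + 2)) := by
            gcongr; norm_num
        _ = _ := by ring
    have hpos' := (ballRivoalSum_pos har' hr (2 * m)).le
    calc _ ≤ 2 * (Nat.lcmUpto (2 * (m + 1)) : ℝ) ^ a *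
          ((K * (2 * m + 2)) ^ 2 * ballRivoalSum a r (2 * m + 2)) := by gcongr
      _ = _ := by rw [show 2 * (m + 1) = 2 * m + 2 by ring]; ring
  · obtain ⟨q, hq⟩ : ∃ q, q = a - 2 * r := ⟨_, rfl⟩
    rw [← hq] at hα
    have hρ0 : 0 < β ^ s * α := by positivity
    have hlim := (tendsto_add_one_pow_mul_pow (3 * s + q) (pow_pos hρ0 2)
      (pow_lt_one₀ hρ0.le hlt two_ne_zero)).const_mul
      ((24 * (a.factorial * C ^ a) * β ^ 2 * K ^ 2) ^ s *
        (2 * C ^ a * (Real.exp 1 * 2) ^ q * Z))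
    rw [mul_zero] at hlim
    refine squeeze_zero (fun m ↦ ?_) (fun m ↦ ?_) hlim
    · have := ballRivoalSum_pos har' hr (2 * m)
      positivity
    have hm : (0 : ℝ) ≤ m := m.cast_nonneg
    have h1 : 2 * (2 * ((m + 1 : ℕ) : ℝ) + 1) * (a.factorial * C ^ a) * β ^ (2 * (m + 1)) *
        (K * (2 * m + 2)) ^ 2 ≤
        24 * (a.factorial * C ^ a) * β ^ 2 * K ^ 2 * (m + 1) ^ 3 * β ^ (2 * m) := by
      calc _ ≤ 2 * (3 * ((m : ℝ) + 1)) * (a.factorial * C ^ a) * β ^ (2 * (m + 1)) *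
            (K * (2 * m + 2)) ^ 2 := by
            gcongr
            push_cast
            linarith
        _ = _ := by ring
    have h2 : 2 * (Nat.lcmUpto (2 * m) : ℝ) ^ a * ballRivoalSum a r (2 * m) ≤
        2 * C ^ a * (Real.exp 1 * 2) ^ q * Z * (m + 1) ^ q * α ^ (2 * m) := by
      calc _ ≤ 2 * (C * (303 / 100 : ℝ) ^ (2 * m)) ^ a *
            ((Real.exp 1 * (2 * (m + 1)) * ((Real.exp 1 * r) ^ (2 * m))⁻¹) ^ q * Z) := by
            have hS := ballRivoalSum_le har' hr (2 * m)
            rw [← hZ, ← hq] at hS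
            have hS' := ballRivoalSum_pos har' hr (2 * m)
            refine mul_le_mul (by gcongr; exact hC _) (hS.trans ?_) hS'.le (by positivity)
            gcongr
            refine (factorial_div_mul_pow_le hr (2 * m)).trans ?_
            gcongr
            push_cast
            linarith
        _ = _ := by
            rw [hα]
            simp only [mul_pow, inv_pow, ← pow_mul]
            ring
    calc _ ≤ (24 * (a.factorial * C ^ a) * β ^ 2 * K ^ 2 * (m + 1) ^ 3 * β ^ (2 * m)) ^ s *
          (2 * C ^ a * (Real.exp 1 * 2) ^ q * Z * (m + 1) ^ q * α ^ (2 * m)) := by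
          have := ballRivoalSum_pos har' hr (2 * m)
          gcongr
      _ = _ := by
          simp only [mul_pow, ← pow_mul]
          ring

theorem quadratic_mul_pow_le (j : ℕ) :
    (1.7 + 3.63 * j + 2.95 * j ^ 2) * (0.35 : ℝ) ^ j ≤ 2.9 := by
  rcases Nat.eq_zero_or_pos j with rfl | hj
  · norm_num
  induction j, hj using Nat.le_induction with
  | base => norm_num
  | succ j hj ih =>
    refine le_trans ?_ ih
    have hj' : (1 : ℝ) ≤ j := by exact_mod_cast hj
    rw [pow_succ (0.35 : ℝ), mul_comm ((0.35 : ℝ) ^ j), ← mul_assoc]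
    refine mul_le_mul_of_nonneg_right ?_ (by positivity)
    push_cast
    nlinarith

theorem ball_rivoal_parameters (j : ℕ) :
    ((303 / 100 : ℝ) ^ (20 ^ (j + 1) + 1) * (2 ^ (20 ^ (j + 1) + 1) *
        ((2 * 7 ^ j : ℕ) + 1) ^ (2 * (2 * 7 ^ j) + 2))) ^ j *
      ((303 / 100) ^ (20 ^ (j + 1) + 1) *
        ((Real.exp 1 * (2 * 7 ^ j : ℕ)) ^ (20 ^ (j + 1) + 1 - 2 * (2 * 7 ^ j)))⁻¹) < 1 := by
  have hle : 2 * (2 * 7 ^ j) ≤ 20 ^ (j + 1) + 1 := by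
    have : 7 ^ j ≤ 20 ^ j := Nat.pow_le_pow_left (by norm_num) j
    rw [pow_succ]
    omega
  have hr1 : 1 ≤ 7 ^ j := Nat.one_le_pow _ _ (by norm_num)
  have h7 : Real.log 7 ≤ 17 / 6 * Real.log 2 := by
    have h : Real.log (7 ^ 6) ≤ Real.log (2 ^ 17) := Real.log_le_log (by norm_num) (by norm_num)
    rw [Real.log_pow, Real.log_pow] at h
    push_cast at h
    linarith
  have h3 : Real.log 3 ≤ 8 / 5 * Real.log 2 := by
    have h : Real.log (3 ^ 5) ≤ Real.log (2 ^ 8) := Real.log_le_log (by norm_num) (by norm_num)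
    rw [Real.log_pow, Real.log_pow] at h
    push_cast at h
    linarith
  have hD : Real.log (303 / 100) ≤ Real.log 2 + 0.515 := by
    have h := Real.log_le_sub_one_of_pos (show (0 : ℝ) < 303 / 100 / 2 by norm_num)
    rw [Real.log_div (by norm_num) (by norm_num)] at h
    linarith
  have hD7 : Real.log (303 / 100) + Real.log 2 + 0.134 ≤ Real.log 7 := by
    have h := Real.log_le_sub_one_of_pos (show (0 : ℝ) < 303 / 100 * 2 / 7 by norm_num)
    rw [Real.log_div (by norm_num) (by norm_num), Real.log_mul (by norm_num) (by norm_num)] at h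
    linarith
  have h2 := Real.log_two_lt_d9
  have hlogr : Real.log ((2 * 7 ^ j : ℕ) : ℝ) = Real.log 2 + j * Real.log 7 := by
    push_cast
    rw [Real.log_mul (by norm_num) (by positivity), Real.log_pow]
  have hlogr1 : Real.log ((2 * 7 ^ j : ℕ) + 1) ≤ Real.log 3 + j * Real.log 7 := by
    rw [← Real.log_pow, ← Real.log_mul (by norm_num) (by positivity)]
    refine Real.log_le_log (by positivity) ?_
    have : (1 : ℝ) ≤ 7 ^ j := by exact_mod_cast hr1
    push_cast
    linarith
  have hx : (7 : ℝ) ^ j = 0.35 ^ j * 20 ^ j := by rw [← mul_pow]; norm_num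
  have hp := quadratic_mul_pow_le j
  have hj0 : (0 : ℝ) ≤ j := j.cast_nonneg
  have hx0 : (0 : ℝ) < 0.35 ^ j := by positivity
  have hr1' : (1 : ℝ) ≤ 7 ^ j := by exact_mod_cast hr1
  have hlog7 : 0 ≤ Real.log 7 := Real.log_nonneg (by norm_num)
  have hlog2 : 0 ≤ Real.log 2 := Real.log_nonneg (by norm_num)
  rw [← Real.log_neg_iff (by positivity), Real.log_mul (by positivity) (by positivity),
    Real.log_pow, Real.log_mul (by positivity) (by positivity),
    Real.log_mul (by positivity) (by positivity), Real.log_mul (by positivity) (by positivity),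
    Real.log_inv, Real.log_pow, Real.log_pow, Real.log_pow, Real.log_pow,
    Real.log_mul (by positivity) (by positivity), Real.log_exp, hlogr, Nat.cast_sub hle]
  push_cast at hlogr1 ⊢
  have hR0 : 0 ≤ Real.log ((2 : ℝ) * 7 ^ j + 1) := Real.log_nonneg (by linarith)
  generalize Real.log (2 * 7 ^ j + 1) = R at *
  have ha : (20 : ℝ) ^ (j + 1) + 1 ≥ 20 * 20 ^ j := by rw [pow_succ]; linarith
  generalize (20 : ℝ) ^ (j + 1) + 1 = A at *
  have hA0 : 0 < A := lt_of_lt_of_le (by positivity) ha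
  have hr : 2 * (2 * (7 : ℝ) ^ j) ≤ 0.2 * 0.35 ^ j * A := by rw [hx]; nlinarith
  have hr' : 2 * (2 * (7 : ℝ) ^ j) + 2 ≤ 0.3 * 0.35 ^ j * A := by linarith
  have hloss : 2 * (2 * (7 : ℝ) ^ j) * (1 + (Real.log 2 + j * Real.log 7)) +
      j * ((2 * (2 * (7 : ℝ) ^ j) + 2) * R) ≤
      0.2 * A * ((1.7 + 3.63 * j + 2.95 * j ^ 2) * 0.35 ^ j) := by
    have hlr : 1 + (Real.log 2 + j * Real.log 7) ≤ 1.7 + 1.9644 * j := by nlinarith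
    have hR : R ≤ 1.1104 + 1.9644 * j := by nlinarith
    calc _ ≤ 0.2 * 0.35 ^ j * A * (1.7 + 1.9644 * j) +
          j * (0.3 * 0.35 ^ j * A * (1.1104 + 1.9644 * j)) := by
          gcongr
      _ = 0.2 * A * ((1.7 + 3.63 * j + 2.9466 * j ^ 2) * 0.35 ^ j) := by ring
      _ ≤ _ := by gcongr; norm_num
  have hgain : A * (j * (Real.log (303 / 100) + Real.log 2) + Real.log (303 / 100) - 1 -
      (Real.log 2 + j * Real.log 7)) ≤ A * (-0.485 - 0.134 * j) := by
    refine mul_le_mul_of_nonneg_left ?_ hA0.le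
    nlinarith [mul_le_mul_of_nonneg_left hD7 hj0]
  have hfin : 0.2 * A * ((1.7 + 3.63 * j + 2.95 * j ^ 2) * 0.35 ^ j) + A * (-0.485 - 0.134 * j)
      < 0 := by
    rcases Nat.eq_zero_or_pos j with rfl | hj
    · norm_num
      linarith
    · have hj' : (1 : ℝ) ≤ j := by exact_mod_cast hj
      nlinarith
  linarith

/-- For every odd `ℓ ≥ 3` one has `δ_ℓ ≥ (1/3) · log ℓ`. -/
theorem ball_rivoal_one_third_log (ℓ : ℕ) (hℓ : 3 ≤ ℓ) (hodd : Odd ℓ) :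
    (1 / 3 : ℝ) * Real.log ℓ ≤ (deltaDim ℓ : ℝ) := by
  have hfin : (({1} : Set ℝ) ∪ {x : ℝ | ∃ s : ℕ, Odd s ∧ 3 ≤ s ∧ s ≤ ℓ ∧ x = zetaR s}).Finite := by
    refine (Set.finite_singleton 1).union (((Set.finite_Iic ℓ).image zetaR).subset ?_)
    rintro x ⟨s, -, -, hs, rfl⟩
    exact ⟨s, hs, rfl⟩
  have := FiniteDimensional.span_of_finite ℚ hfin
  rw [deltaDim]
  set V := Submodule.span ℚ
    (({1} : Set ℝ) ∪ {x : ℝ | ∃ s : ℕ, Odd s ∧ 3 ≤ s ∧ s ≤ ℓ ∧ x = zetaR s})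
  have h1V : (1 : ℝ) ∈ V := Submodule.subset_span (Or.inl rfl)
  refine (Nat.le_ceil _).trans (Nat.cast_le.2 ?_)
  obtain ⟨k, hk⟩ : ∃ k, k = ⌈(1 / 3 : ℝ) * Real.log ℓ⌉₊ := ⟨_, rfl⟩
  rw [← hk]
  rcases k with - | - | j
  · exact Nat.zero_le _
  · have : Nontrivial V := ⟨⟨1, h1V⟩, 0, fun h ↦ one_ne_zero (congrArg Subtype.val h)⟩
    exact Module.finrank_pos
  have hlog : ((j + 1 : ℕ) : ℝ) < 1 / 3 * Real.log ℓ := Nat.lt_ceil.1 (by omega)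
  have hℓa : 20 ^ (j + 1) + 1 ≤ ℓ := by
    have h1 : Real.exp 1 ^ (3 * (j + 1)) < ℓ := by
      rw [← Real.exp_nat_mul, ← Real.lt_log_iff_exp_lt (by positivity)]
      push_cast at hlog ⊢
      linarith
    have h2 : (20 : ℝ) ≤ Real.exp 1 ^ 3 :=
      le_trans (by norm_num) (pow_le_pow_left₀ (by norm_num) Real.exp_one_gt_d9.le 3)
    have h3 : ((20 ^ (j + 1) : ℕ) : ℝ) < ℓ := by
      refine lt_of_le_of_lt ?_ h1
      rw [pow_mul]
      push_cast
      gcongr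
    exact_mod_cast h3
  refine lt_finrank_of_zetaVector_mem (a := 20 ^ (j + 1) + 1) (r := 2 * 7 ^ j) ?_ ?_ ?_ ?_
    (ball_rivoal_parameters j)
  · exact (Even.pow_of_ne_zero (by decide) (Nat.succ_ne_zero j)).add_one
  · have : 1 ≤ 7 ^ j := Nat.one_le_pow _ _ (by norm_num)
    omega
  · have h7 : 7 ^ j ≤ 20 ^ j := Nat.pow_le_pow_left (by norm_num) j
    have h1 : 1 ≤ 20 ^ j := Nat.one_le_pow _ _ (by norm_num)
    rw [pow_succ]
    omega
  · rintro (- | i)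
    · exact h1V
    · rw [zetaVector]
      split_ifs with h
      · refine Submodule.subset_span (Or.inr ⟨i + 1, h.1.add_one, ?_, ?_, rfl⟩)
        · obtain ⟨⟨y, hy⟩, h0⟩ := h
          omega
        · omega
      · exact V.zero_mem
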